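/- arXiv:2506.09635 — 3 statements merged into one kernel-verified Lean document; each statement's English description precedes it below -/
import Mathlib

section
/- For every ν > 0 there exist functions j₊, j₋ : [1,∞) → ℂ, infinitely differentiable, and constants C_{ν,N} for each N ∈ ℕ, such that J_ν(r) = r^{-1/2} ( e^{ir} j₊(r) + e^{-ir} j₋(r) ) for all r ≥ 1, with |j₊(r)| ≤ C_{ν,0} and |j₋(r)| ≤ C_{ν,0} for all r ≥ 1, and |(d/dr)^N j₊(r)| ≤ C_{ν,N} r^{-N-1} and |(d/dr)^N j₋(r)| ≤ C_{ν,N} r^{-N-1} for all N ≥ 1 and r ≥ 1. -/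
open MeasureTheory

/-- The Bessel function of order `ν`, defined for `ν > -1/2` and `r > 0` by the
Poisson integral representation
`J_ν(r) = (r/2)^ν / (Γ(ν+1/2)Γ(1/2)) ∫_{-1}^{1} e^{isr} (1-s²)^{ν-1/2} ds`. -/
noncomputable def besselJ (ν r : ℝ) : ℂ :=
  (((r / 2) ^ ν / (Real.Gamma (ν + 1 / 2) * Real.Gamma (1 / 2)) : ℝ) : ℂ) *
    ∫ s in (-1 : ℝ)..1,
      Complex.exp (Complex.I * (s : ℂ) * (r : ℂ)) * (((1 - s ^ 2) ^ (ν - 1 / 2) : ℝ) : ℂ)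

open Set Filter Topology

namespace BesselAux

/-- The integrand of the Laplace-type integral. -/
noncomputable def phi (c : ℂ) (a : ℝ) (n : ℕ) (x u : ℝ) : ℂ :=
  ((Real.exp (-u) * u ^ (a + n) : ℝ) : ℂ) * ((u : ℂ) * x + c) ^ (((a - n : ℝ)) : ℂ)

noncomputable def F (c : ℂ) (a : ℝ) (n : ℕ) (x : ℝ) : ℂ :=
  ∫ u in Ioi (0 : ℝ), phi c a n x u

lemma norm_cpow_real {z : ℂ} (hz : z ≠ 0) (b : ℝ) : ‖z ^ (b : ℂ)‖ = ‖z‖ ^ b := by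
  rw [Complex.norm_cpow_of_ne_zero hz]; simp

lemma one_le_norm (c : ℂ) (hc : 1 ≤ |c.im|) (u x : ℝ) : 1 ≤ ‖(u : ℂ) * x + c‖ := by
  have := Complex.abs_im_le_norm ((u : ℂ) * x + c)
  simp at this
  linarith

lemma mem_slit (c : ℂ) (hc : 1 ≤ |c.im|) (u x : ℝ) : (u : ℂ) * x + c ∈ Complex.slitPlane := by
  right
  simp
  rintro h
  simp [h] at hc
  linarith

lemma one_add_rpow_le {u q : ℝ} (hu : 0 < u) (hq : 0 ≤ q) :
    (1 + u) ^ q ≤ 2 ^ q * (1 + u ^ q) := by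
  have h2 : (0:ℝ) ≤ 2 ^ q := by positivity
  have h3 : (0:ℝ) ≤ u ^ q := by positivity
  rcases le_total u 1 with h | h
  · have : (1 + u) ^ q ≤ 2 ^ q := Real.rpow_le_rpow (by linarith) (by linarith) hq
    nlinarith
  · have : (1 + u) ^ q ≤ (2 * u) ^ q := Real.rpow_le_rpow (by linarith) (by linarith) hq
    rw [Real.mul_rpow (by norm_num) hu.le] at this
    nlinarith

/-- dominating function -/
noncomputable def bd (c : ℂ) (X p q : ℝ) (u : ℝ) : ℝ :=
  (X + ‖c‖) ^ q * 2 ^ q * (Real.exp (-u) * u ^ p + Real.exp (-u) * u ^ (p + q))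

lemma bd_integrable (c : ℂ) (X p q : ℝ) (hp : -1 < p) (hq : 0 ≤ q) :
    IntegrableOn (bd c X p q) (Ioi 0) := by
  have h1 := Real.GammaIntegral_convergent (s := p + 1) (by linarith)
  have h2 := Real.GammaIntegral_convergent (s := p + q + 1) (by linarith)
  simp only [add_sub_cancel_right] at h1 h2
  exact (h1.add h2).const_mul _

lemma phi_bound (c : ℂ) (hc : 1 ≤ |c.im|) (a : ℝ) (n : ℕ) (x X u : ℝ) (hx : |x| ≤ X) (hu : 0 < u) :
    ‖phi c a n x u‖ ≤ bd c X (a + n) |a - n| u := by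
  have h1 := one_le_norm c hc u x
  have hX : 0 ≤ X := (abs_nonneg x).trans hx
  have hc0 := norm_nonneg c
  have hz : (u : ℂ) * x + c ≠ 0 := by
    intro h; rw [h] at h1; simp at h1; linarith
  have h2 : ‖(u : ℂ) * x + c‖ ≤ (X + ‖c‖) * (1 + u) := by
    refine (norm_add_le _ _).trans ?_
    rw [norm_mul, Complex.norm_real, Complex.norm_real, Real.norm_eq_abs, Real.norm_eq_abs,
      abs_of_pos hu]
    nlinarith [mul_nonneg hc0 hu.le, mul_le_mul_of_nonneg_left hx hu.le]
  have h3 : ‖(u : ℂ) * x + c‖ ^ (a - n) ≤ (X + ‖c‖) ^ |a - n| * (2 ^ |a - n| * (1 + u ^ |a - n|)) := by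
    calc ‖(u : ℂ) * x + c‖ ^ (a - n) ≤ ‖(u : ℂ) * x + c‖ ^ |a - n| :=
          Real.rpow_le_rpow_of_exponent_le h1 (le_abs_self _)
      _ ≤ ((X + ‖c‖) * (1 + u)) ^ |a - n| := Real.rpow_le_rpow (norm_nonneg _) h2 (abs_nonneg _)
      _ = (X + ‖c‖) ^ |a - n| * (1 + u) ^ |a - n| := Real.mul_rpow (by positivity) (by positivity)
      _ ≤ _ := by
          gcongr
          exact one_add_rpow_le hu (abs_nonneg _)
  unfold phi bd
  rw [norm_mul, norm_cpow_real hz, Complex.norm_real, Real.norm_eq_abs, abs_of_nonneg (by positivity),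
    Real.rpow_add hu (a + n) |a - n|]
  calc _ ≤ Real.exp (-u) * u ^ (a + n) * ((X + ‖c‖) ^ |a - n| * (2 ^ |a - n| * (1 + u ^ |a - n|))) := by
        gcongr
    _ = _ := by ring

lemma phi_continuousOn (c : ℂ) (hc : 1 ≤ |c.im|) (a : ℝ) (n : ℕ) (x : ℝ) :
    ContinuousOn (phi c a n x) (Ioi 0) := by
  intro u hu
  have hu' : u ≠ 0 := ne_of_gt hu
  apply ContinuousAt.continuousWithinAt
  unfold phi
  refine ContinuousAt.mul ?_ ?_
  · refine Complex.continuous_ofReal.continuousAt.comp ?_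
    refine ContinuousAt.mul (by fun_prop) ?_
    exact Real.continuousAt_rpow_const _ _ (Or.inl hu')
  · refine ContinuousAt.cpow (by fun_prop) continuousAt_const (mem_slit c hc u x)

lemma phi_meas (c : ℂ) (hc : 1 ≤ |c.im|) (a : ℝ) (n : ℕ) (x : ℝ) :
    AEStronglyMeasurable (phi c a n x) (volume.restrict (Ioi 0)) :=
  (phi_continuousOn c hc a n x).aestronglyMeasurable measurableSet_Ioi

lemma phi_integrable (c : ℂ) (hc : 1 ≤ |c.im|) (a : ℝ) (ha : -1 < a) (n : ℕ) (x : ℝ) :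
    IntegrableOn (phi c a n x) (Ioi 0) := by
  refine Integrable.mono' (bd_integrable c |x| (a + n) |a - n| ?_ (abs_nonneg _)) 
    (phi_meas c hc a n x) ?_
  · have : (0:ℝ) ≤ n := n.cast_nonneg
    linarith
  · filter_upwards [ae_restrict_mem measurableSet_Ioi] with u hu
    exact phi_bound c hc a n x _ u le_rfl hu

lemma phi_hasDerivAt (c : ℂ) (hc : 1 ≤ |c.im|) (a : ℝ) (n : ℕ) (x u : ℝ) (hu : 0 < u) :
    HasDerivAt (fun x => phi c a n x u) (((a - n : ℝ) : ℂ) * phi c a (n + 1) x u) x := by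
  unfold phi
  have h1 : HasDerivAt (fun w : ℂ => (u : ℂ) * w + c) (u : ℂ) (x : ℂ) := by
    have := (hasDerivAt_id (x : ℂ)).const_mul (u : ℂ)
    simpa using this.add_const c
  have h2 := ((h1.cpow_const (c := ((a - n : ℝ) : ℂ)) (mem_slit c hc u x)).const_mul
    (((Real.exp (-u) * u ^ (a + n) : ℝ) : ℂ))).comp_ofReal
  convert! h2 using 1
  have e1 : u ^ (a + ((n + 1 : ℕ) : ℝ)) = u ^ (a + n) * u := by
    rw [← Real.rpow_add_one hu.ne']; push_cast; ring_nf
  have e2 : (((a - ((n + 1 : ℕ) : ℝ) : ℝ)) : ℂ) = ((a - n : ℝ) : ℂ) - 1 := by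
    push_cast; ring
  rw [e1, e2]
  push_cast
  ring

lemma F_hasDerivAt (c : ℂ) (hc : 1 ≤ |c.im|) (a : ℝ) (ha : -1 < a) (n : ℕ) (x : ℝ) :
    HasDerivAt (F c a n) (((a - n : ℝ) : ℂ) * F c a (n + 1) x) x := by
  have hn : (0:ℝ) ≤ ((n + 1 : ℕ) : ℝ) := Nat.cast_nonneg _
  have := (hasDerivAt_integral_of_dominated_loc_of_deriv_le (μ := volume.restrict (Ioi (0:ℝ)))
    (F := phi c a n) (x₀ := x) (s := Metric.ball x 1)
    (F' := fun x u => ((a - n : ℝ) : ℂ) * phi c a (n + 1) x u)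
    (bound := fun u => |a - n| * bd c (|x| + 1) (a + (n + 1 : ℕ)) |a - (n + 1 : ℕ)| u)
    (Metric.ball_mem_nhds x one_pos)
    (Eventually.of_forall fun y => phi_meas c hc a n y) (phi_integrable c hc a ha n x)
    ((phi_meas c hc a (n + 1) x).const_mul _) ?_ ?_ ?_).2
  · rw [integral_const_mul] at this
    exact this
  · filter_upwards [ae_restrict_mem measurableSet_Ioi] with u hu y hy
    rw [norm_mul, Complex.norm_real, Real.norm_eq_abs]
    gcongr
    refine phi_bound c hc a (n + 1) y _ u ?_ hu
    rw [Metric.mem_ball, Real.dist_eq] at hy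
    have := abs_sub_abs_le_abs_sub y x
    linarith
  · exact (bd_integrable c _ _ _ (by linarith) (abs_nonneg _)).const_mul _
  · filter_upwards [ae_restrict_mem measurableSet_Ioi] with u hu y hy
    exact phi_hasDerivAt c hc a n y u hu

lemma F_contDiff (c : ℂ) (hc : 1 ≤ |c.im|) (a : ℝ) (ha : -1 < a) :
    ContDiff ℝ (⊤ : ℕ∞) (F c a 0) := by
  have key : ∀ m n : ℕ, ContDiff ℝ m (F c a n) := by
    intro m
    induction m with
    | zero =>
      intro n
      rw [Nat.cast_zero, contDiff_zero]
      exact continuous_iff_continuousAt.2 fun x => (F_hasDerivAt c hc a ha n x).continuousAt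
    | succ m ih =>
      intro n
      rw [Nat.cast_succ, contDiff_succ_iff_deriv]
      refine ⟨fun x => (F_hasDerivAt c hc a ha n x).differentiableAt, by simp, ?_⟩
      have : deriv (F c a n) = fun x => ((a - n : ℝ) : ℂ) * F c a (n + 1) x :=
        funext fun x => (F_hasDerivAt c hc a ha n x).deriv
      rw [this]
      exact contDiff_const.mul (ih (n + 1))
  exact contDiff_infty.2 fun m => key m 0

lemma step_deriv (G : ℝ → ℂ) (hG : ContDiff ℝ (⊤ : ℕ∞) G) (k : ℕ) (r : ℝ) (hr : 1 ≤ r) :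
    HasDerivAt (fun r : ℝ => ((r⁻¹ ^ k : ℝ) : ℂ) * G r⁻¹)
      (((r⁻¹ ^ (k + 1) : ℝ) : ℂ) * (-(k : ℂ) * G r⁻¹ - ((r⁻¹ : ℝ) : ℂ) * deriv G r⁻¹)) r := by
  have hr0 : r ≠ 0 := by positivity
  have h1 : HasDerivAt (fun r : ℝ => r⁻¹) (-(r ^ 2)⁻¹) r := hasDerivAt_inv hr0
  have h2 : HasDerivAt (fun r : ℝ => ((r⁻¹ ^ k : ℝ) : ℂ)) _ r := (h1.pow k).ofReal_comp
  have h3 : HasDerivAt G (deriv G r⁻¹) r⁻¹ :=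
    (hG.differentiable (by simp) _).hasDerivAt
  have h4 := h3.scomp r h1
  convert! h2.mul h4 using 1
  have hrc : (r : ℂ) ≠ 0 := by exact_mod_cast hr0
  rcases k with _ | k
  · simp
    field_simp
  · simp
    field_simp
    ring

lemma iter_form (f : ℝ → ℂ) (hf : ContDiff ℝ (⊤ : ℕ∞) f) (N : ℕ) :
    ∃ G : ℝ → ℂ, ContDiff ℝ (⊤ : ℕ∞) G ∧ ∀ r : ℝ, 1 ≤ r →
      iteratedDerivWithin (N + 1) (fun r : ℝ => f r⁻¹) (Ici 1) r
        = ((r⁻¹ ^ (N + 2) : ℝ) : ℂ) * G r⁻¹ := by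
  have hd : ∀ G : ℝ → ℂ, ContDiff ℝ (⊤ : ℕ∞) G → ContDiff ℝ (⊤ : ℕ∞) (deriv G) := by
    intro G hG
    exact (contDiff_infty_iff_deriv.1 hG).2
  induction N with
  | zero =>
    refine ⟨fun x => - deriv f x, (hd f hf).neg, fun r hr => ?_⟩
    rw [iteratedDerivWithin_one]
    have h := step_deriv f hf 0 r hr
    have := h.hasDerivWithinAt (s := Ici 1) |>.derivWithin (uniqueDiffOn_Ici 1 r hr)
    simp at this
    rw [this]
    push_cast; ring
  | succ N ih =>
    obtain ⟨G, hG, h⟩ := ih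
    refine ⟨fun x => -((N + 2 : ℕ) : ℂ) * G x - (x : ℂ) * deriv G x, ?_, fun r hr => ?_⟩
    · exact (contDiff_const.mul hG).sub ((Complex.ofRealCLM.contDiff).mul (hd G hG))
    · rw [iteratedDerivWithin_succ]
      rw [derivWithin_congr (s := Ici 1) (fun y hy => h y hy) (h r hr)]
      exact (step_deriv G hG (N + 2) r hr).hasDerivWithinAt.derivWithin (uniqueDiffOn_Ici 1 r hr)

lemma comp_contDiffOn (f : ℝ → ℂ) (hf : ContDiff ℝ (⊤ : ℕ∞) f) :
    ContDiffOn ℝ (⊤ : ℕ∞) (fun r : ℝ => f r⁻¹) (Ici 1) := by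
  refine hf.comp_contDiffOn (contDiffOn_id.inv ?_)
  intro x hx
  have : (1:ℝ) ≤ x := hx
  simp only [id]
  positivity

lemma bounded_inv (G : ℝ → ℂ) (hG : ContDiff ℝ (⊤ : ℕ∞) G) :
    ∃ C : ℝ, 0 < C ∧ ∀ r : ℝ, 1 ≤ r → ‖G r⁻¹‖ ≤ C := by
  obtain ⟨C, hC⟩ := (isCompact_Icc (a := (0:ℝ)) (b := 1)).exists_bound_of_continuousOn
    hG.continuous.continuousOn
  refine ⟨max C 1, by positivity, fun r hr => (hC _ ⟨by positivity, inv_le_one_of_one_le₀ hr⟩).trans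
    (le_max_left _ _)⟩

lemma comp_bounds (f : ℝ → ℂ) (hf : ContDiff ℝ (⊤ : ℕ∞) f) :
    ∃ C : ℕ → ℝ, (∀ N, 0 < C N) ∧ (∀ r : ℝ, 1 ≤ r → ‖f r⁻¹‖ ≤ C 0) ∧
      ∀ N : ℕ, 1 ≤ N → ∀ r : ℝ, 1 ≤ r →
        ‖iteratedDerivWithin N (fun r : ℝ => f r⁻¹) (Ici 1) r‖ ≤ C N * r ^ (-(N : ℝ) - 1) := by
  have : ∀ N : ℕ, ∃ C : ℝ, 0 < C ∧ ∀ r : ℝ, 1 ≤ r →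
      ‖iteratedDerivWithin (N + 1) (fun r : ℝ => f r⁻¹) (Ici 1) r‖
        ≤ C * r ^ (-((N + 1 : ℕ) : ℝ) - 1) := by
    intro N
    obtain ⟨G, hG, h⟩ := iter_form f hf N
    obtain ⟨C, hC, hb⟩ := bounded_inv G hG
    refine ⟨C, hC, fun r hr => ?_⟩
    have hr0 : 0 < r := by linarith
    have e : r ^ (-((N + 1 : ℕ) : ℝ) - 1) = r⁻¹ ^ (N + 2) := by
      rw [inv_pow, ← Real.rpow_natCast, ← Real.rpow_neg hr0.le]
      congr 1
      push_cast; ring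
    rw [h r hr, e, norm_mul, Complex.norm_real, Real.norm_of_nonneg (by positivity), mul_comm]
    gcongr
    exact hb r hr
  choose C hC hb using this
  obtain ⟨C0, hC0, hb0⟩ := bounded_inv f hf
  refine ⟨fun N => Nat.casesOn N C0 C, ?_, hb0, ?_⟩
  · rintro (_ | N)
    · exact hC0
    · exact hC N
  · rintro (_ | N) hN
    · omega
    · exact hb N

/-- The analytically continued integrand. -/
noncomputable def g (a r : ℝ) (z : ℂ) : ℂ :=
  Complex.exp (Complex.I * z * r) * (1 - z ^ 2) ^ (a : ℂ)

lemma re_formula (s y : ℝ) : (1 - ((s : ℂ) + y * Complex.I) ^ 2).re = 1 - s ^ 2 + y ^ 2 := by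
  simp [pow_two]
  ring

lemma slit_of {s y : ℝ} (h : 0 < 1 - s ^ 2 + y ^ 2) :
    1 - ((s : ℂ) + y * Complex.I) ^ 2 ∈ Complex.slitPlane := by
  left
  rw [re_formula]
  exact h

lemma g_diffAt (a r : ℝ) {z : ℂ} (h : 1 - z ^ 2 ∈ Complex.slitPlane) :
    DifferentiableAt ℂ (g a r) z := by
  unfold g
  refine DifferentiableAt.mul (by fun_prop) ?_
  exact DifferentiableAt.cpow (by fun_prop) (by fun_prop) h

lemma norm_exp_part (r s y : ℝ) :
    ‖Complex.exp (Complex.I * ((s : ℂ) + y * Complex.I) * r)‖ = Real.exp (-r * y) := by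
  rw [Complex.norm_exp]
  congr 1
  simp
  ring

lemma norm_le_part (s y : ℝ) (hs : |s| ≤ 1) :
    ‖1 - ((s : ℂ) + y * Complex.I) ^ 2‖ ≤ 2 + y ^ 2 := by
  have h : ‖((s : ℂ) + y * Complex.I) ^ 2‖ = s ^ 2 + y ^ 2 := by
    rw [norm_pow, ← Complex.normSq_eq_norm_sq, Complex.normSq_add_mul_I]
  have hs2 : s ^ 2 ≤ 1 := by rw [← sq_abs]; exact pow_le_one₀ (abs_nonneg _) hs
  calc _ ≤ ‖(1:ℂ)‖ + ‖((s : ℂ) + y * Complex.I) ^ 2‖ := norm_sub_le _ _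
    _ ≤ _ := by rw [h, norm_one]; linarith

lemma norm_ge_part (s y : ℝ) :
    1 - s ^ 2 + y ^ 2 ≤ ‖1 - ((s : ℂ) + y * Complex.I) ^ 2‖ := by
  rw [← re_formula]
  exact Complex.re_le_norm _

lemma norm_g (a r s y : ℝ) (h : 0 < 1 - s ^ 2 + y ^ 2) :
    ‖g a r ((s : ℂ) + y * Complex.I)‖ =
      Real.exp (-r * y) * ‖1 - ((s : ℂ) + y * Complex.I) ^ 2‖ ^ a := by
  unfold g
  rw [norm_mul, norm_exp_part, norm_cpow_real (Complex.slitPlane_ne_zero (slit_of h))]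

lemma real_mul_cpow {y : ℝ} (hy : 0 < y) {w : ℂ} (hw : w ≠ 0) (a : ℝ) :
    ((y : ℂ) * w) ^ (a : ℂ) = ((y ^ a : ℝ) : ℂ) * w ^ (a : ℂ) := by
  have hy' : (y : ℂ) ≠ 0 := by exact_mod_cast hy.ne'
  rw [Complex.ofReal_cpow hy.le, Complex.cpow_def_of_ne_zero (mul_ne_zero hy' hw),
    Complex.cpow_def_of_ne_zero hy', Complex.cpow_def_of_ne_zero hw, Complex.log_ofReal_mul hy hw,
    ← Complex.exp_add, Complex.ofReal_log hy.le]
  ring_nf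

lemma g_vertical (a r σ y : ℝ) (hσ : σ ^ 2 = 1) (hr : 1 ≤ r) (hy : 0 < y) :
    g a r ((σ : ℂ) + y * Complex.I) =
      Complex.exp (Complex.I * σ * r) * ((r ^ (-a) : ℝ) : ℂ) *
        phi (-2 * σ * Complex.I) a 0 r⁻¹ (r * y) := by
  have hr0 : 0 < r := by linarith
  have hrc : (r : ℂ) ≠ 0 := by exact_mod_cast hr0.ne'
  have hσc : (σ : ℂ) ^ 2 = 1 := by exact_mod_cast hσ
  have hw : (y : ℂ) + -2 * σ * Complex.I ≠ 0 := by
    intro h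
    have := congrArg Complex.re h
    simp at this
    linarith
  have e1 : 1 - ((σ : ℂ) + y * Complex.I) ^ 2 = (y : ℂ) * ((y : ℂ) + -2 * σ * Complex.I) := by
    linear_combination -hσc - (y : ℂ) ^ 2 * Complex.I_sq
  have e2 : Complex.exp (Complex.I * ((σ : ℂ) + y * Complex.I) * r) =
      Complex.exp (Complex.I * σ * r) * Complex.exp (-(r * y)) := by
    rw [← Complex.exp_add]
    congr 1
    linear_combination (y : ℂ) * r * Complex.I_sq
  have e3 : ((r * y : ℝ) : ℂ) * ((r⁻¹ : ℝ) : ℂ) = y := by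
    push_cast; field_simp
  have e4 : r ^ (-a) * (r * y) ^ a = y ^ a := by
    rw [Real.mul_rpow hr0.le hy.le, ← mul_assoc, ← Real.rpow_add hr0]; simp
  unfold g phi
  rw [e1, e2, e3, real_mul_cpow hy hw, ← e4]
  simp only [Nat.cast_zero, add_zero, sub_zero]
  push_cast
  ring

lemma im_cond (σ : ℝ) (hσ : σ ^ 2 = 1) : 1 ≤ |(-2 * (σ : ℂ) * Complex.I).im| := by
  rcases (sq_eq_sq_iff_eq_or_eq_neg.1 (hσ.trans (one_pow 2).symm)) with h | h <;> simp [h]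

lemma g_vertical_integrable (a r σ : ℝ) (ha : -1 < a) (hσ : σ ^ 2 = 1) (hr : 1 ≤ r) :
    IntegrableOn (fun y : ℝ => g a r ((σ : ℂ) + y * Complex.I)) (Ioi 0) := by
  have hr0 : 0 < r := by linarith
  have h := phi_integrable (-2 * σ * Complex.I) (im_cond σ hσ) a ha 0 r⁻¹
  have h2 := (integrableOn_Ioi_comp_mul_left_iff (phi (-2 * σ * Complex.I) a 0 r⁻¹) 0 hr0).2
    (by simpa using h)
  refine IntegrableOn.congr_fun (h2.const_mul
    (Complex.exp (Complex.I * σ * r) * ((r ^ (-a) : ℝ) : ℂ))) ?_ measurableSet_Ioi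
  intro y hy
  exact (g_vertical a r σ y hσ hr hy).symm

lemma g_vertical_integral (a r σ : ℝ) (hσ : σ ^ 2 = 1) (hr : 1 ≤ r) :
    ∫ y in Ioi (0 : ℝ), g a r ((σ : ℂ) + y * Complex.I) =
      Complex.exp (Complex.I * σ * r) * ((r ^ (-a - 1) : ℝ) : ℂ) *
        F (-2 * σ * Complex.I) a 0 r⁻¹ := by
  have hr0 : 0 < r := by linarith
  rw [setIntegral_congr_fun measurableSet_Ioi fun y hy => g_vertical a r σ y hσ hr hy,
    integral_const_mul, integral_comp_mul_left_Ioi _ _ hr0, mul_zero, Real.rpow_sub_one hr0.ne']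
  unfold F
  rw [Complex.real_smul]
  push_cast
  ring

lemma vertical_tendsto (a r σ : ℝ) (ha : -1 < a) (hσ : σ ^ 2 = 1) (hr : 1 ≤ r) :
    Tendsto (fun T : ℝ => ∫ y in T⁻¹..T, g a r ((σ : ℂ) + y * Complex.I)) atTop
      (𝓝 (∫ y in Ioi (0 : ℝ), g a r ((σ : ℂ) + y * Complex.I))) := by
  have hcov : AECover (volume.restrict (Ioi (0:ℝ))) atTop fun T : ℝ => Ioc T⁻¹ T :=
    (aecover_Ioi_of_Ioi tendsto_inv_atTop_zero).inter (aecover_Iic tendsto_id)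
  have := hcov.integral_tendsto_of_countably_generated (g_vertical_integrable a r σ ha hσ hr)
  refine this.congr' ?_
  filter_upwards [eventually_ge_atTop 1] with T hT
  rw [intervalIntegral.integral_of_le ((inv_le_one_of_one_le₀ hT).trans hT),
    Measure.restrict_restrict measurableSet_Ioc, inter_eq_left.2]
  intro x hx
  exact lt_trans (by positivity) hx.1

lemma top_tendsto (a r : ℝ) (hr : 1 ≤ r) :
    Tendsto (fun T : ℝ => ∫ s in (-1 : ℝ)..1, g a r ((s : ℂ) + T * Complex.I)) atTop (𝓝 0) := by
  have hr0 : 0 < r := by linarith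
  have h1 := (tendsto_rpow_mul_exp_neg_mul_atTop_nhds_zero (2 * |a|) r hr0).const_mul
    (3 ^ |a| * 2)
  rw [mul_zero] at h1
  refine squeeze_zero_norm' ?_ h1
  filter_upwards [eventually_ge_atTop 1] with T hT
  have hT0 : 0 < T := by linarith
  have := intervalIntegral.norm_integral_le_of_norm_le_const (a := -1) (b := 1)
    (f := fun s : ℝ => g a r ((s : ℂ) + T * Complex.I))
    (C := Real.exp (-r * T) * (3 ^ |a| * T ^ (2 * |a|))) ?_
  · refine this.trans (le_of_eq ?_)
    norm_num
    ring
  · intro s hs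
    rw [uIoc_of_le (by norm_num)] at hs
    have hs1 : |s| ≤ 1 := abs_le.2 ⟨hs.1.le, hs.2⟩
    have hs2 : s ^ 2 ≤ 1 := by rw [← sq_abs]; exact pow_le_one₀ (abs_nonneg _) hs1
    have hT2 : 1 ≤ T ^ 2 := one_le_pow₀ hT
    rw [norm_g _ _ _ _ (by linarith)]
    gcongr
    have hge := norm_ge_part s T
    have hle := norm_le_part s T hs1
    calc _ ≤ ‖1 - ((s : ℂ) + T * Complex.I) ^ 2‖ ^ |a| :=
          Real.rpow_le_rpow_of_exponent_le (by linarith) (le_abs_self _)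
      _ ≤ (3 * T ^ 2) ^ |a| := Real.rpow_le_rpow (norm_nonneg _) (by linarith) (abs_nonneg _)
      _ = _ := by
          rw [Real.mul_rpow (by norm_num) (by positivity), Real.rpow_mul hT0.le, Real.rpow_two]

lemma bottom_tendsto (a r : ℝ) (ha : -1 < a) (hr : 1 ≤ r) :
    Tendsto (fun T : ℝ => ∫ s in (-1 : ℝ)..1, g a r ((s : ℂ) + ((T⁻¹ : ℝ) : ℂ) * Complex.I)) atTop
      (𝓝 (∫ s in (-1 : ℝ)..1, g a r (s : ℂ))) := by
  have hr0 : 0 < r := by linarith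
  have hne : ∀ᵐ s : ℝ, s ≠ 1 := by
    simp [ae_iff]
  refine intervalIntegral.tendsto_integral_filter_of_dominated_convergence
    (fun s => (1 - s) ^ a + (1 + s) ^ a + 3 ^ |a|) ?_ ?_ ?_ ?_
  · filter_upwards [eventually_ge_atTop 1] with T hT
    refine ContinuousOn.aestronglyMeasurable ?_ measurableSet_uIoc
    intro s hs
    rw [uIoc_of_le (by norm_num)] at hs
    have hs1 : |s| ≤ 1 := abs_le.2 ⟨hs.1.le, hs.2⟩
    have hs2 : s ^ 2 ≤ 1 := by rw [← sq_abs]; exact pow_le_one₀ (abs_nonneg _) hs1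
    have hT2 : 0 < T⁻¹ ^ 2 := by positivity
    have hc := (g_diffAt a r (slit_of (s := s) (y := T⁻¹) (by linarith))).continuousAt
    refine ContinuousAt.continuousWithinAt ?_
    exact ContinuousAt.comp (f := fun s : ℝ => (s : ℂ) + ((T⁻¹ : ℝ) : ℂ) * Complex.I) hc (by fun_prop)
  · filter_upwards [eventually_ge_atTop 1] with T hT
    filter_upwards [hne] with s hs1 hs
    rw [uIoc_of_le (by norm_num)] at hs
    have hlt : s < 1 := lt_of_le_of_ne hs.2 hs1
    have habs : |s| < 1 := abs_lt.2 ⟨hs.1, hlt⟩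
    have hT0 : 0 < T⁻¹ := by positivity
    have hT1 : T⁻¹ ≤ 1 := inv_le_one_of_one_le₀ hT
    have hT2 : T⁻¹ ^ 2 ≤ 1 := pow_le_one₀ hT0.le hT1
    have hpos : 1 - |s| ≤ 1 - s ^ 2 + T⁻¹ ^ 2 := by
      rw [← sq_abs s]
      nlinarith [abs_nonneg s, sq_nonneg T⁻¹]
    have hge := norm_ge_part s T⁻¹
    have hle := norm_le_part s T⁻¹ habs.le
    have p1 : 0 ≤ (1 - s) ^ a := Real.rpow_nonneg (by linarith) _
    have p2 : 0 ≤ (1 + s) ^ a := Real.rpow_nonneg (by linarith [hs.1]) _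
    have p3 : (0:ℝ) ≤ 3 ^ |a| := by positivity
    rw [norm_g _ _ _ _ (by linarith)]
    have he : Real.exp (-r * T⁻¹) ≤ 1 := by
      rw [Real.exp_le_one_iff]; nlinarith
    refine (mul_le_of_le_one_left (Real.rpow_nonneg (norm_nonneg _) _) he).trans ?_
    rcases le_total 0 a with h0 | h0
    · have : ‖1 - ((s : ℂ) + ((T⁻¹ : ℝ) : ℂ) * Complex.I) ^ 2‖ ^ a ≤ 3 ^ |a| := by
        rw [abs_of_nonneg h0]
        exact Real.rpow_le_rpow (norm_nonneg _) (by linarith) h0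
      linarith
    · have : ‖1 - ((s : ℂ) + ((T⁻¹ : ℝ) : ℂ) * Complex.I) ^ 2‖ ^ a ≤ (1 - |s|) ^ a :=
        Real.rpow_le_rpow_of_nonpos (by linarith) (by linarith) h0
      rcases abs_cases s with ⟨h, _⟩ | ⟨h, _⟩
      · rw [h] at this; linarith
      · rw [h, sub_neg_eq_add] at this; linarith
  · refine IntervalIntegrable.add (IntervalIntegrable.add ?_ ?_) intervalIntegrable_const
    · have := (intervalIntegral.intervalIntegrable_rpow' (a := 2) (b := 0) ha).comp_sub_left 1
      norm_num at this
      exact this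
    · have := (intervalIntegral.intervalIntegrable_rpow' (a := 0) (b := 2) ha).comp_add_left 1
      norm_num at this
      exact this
  · filter_upwards [hne] with s hs1 hs
    rw [uIoc_of_le (by norm_num)] at hs
    have hlt : s < 1 := lt_of_le_of_ne hs.2 hs1
    have hpos : 0 < 1 - s ^ 2 + 0 ^ 2 := by nlinarith [hs.1]
    have hc := (g_diffAt a r (slit_of (s := s) (y := 0) hpos)).continuousAt.tendsto
    have ht : Tendsto (fun T : ℝ => (s : ℂ) + ((T⁻¹ : ℝ) : ℂ) * Complex.I) atTop
        (𝓝 ((s : ℂ) + ((0 : ℝ) : ℂ) * Complex.I)) := by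
      have hcont : Continuous (fun y : ℝ => (s : ℂ) + (y : ℂ) * Complex.I) := by fun_prop
      exact (hcont.tendsto 0).comp tendsto_inv_atTop_zero
    have := hc.comp ht
    simpa [Function.comp_def] using this

lemma contour (a r : ℝ) (ha : -1 < a) (hr : 1 ≤ r) :
    ∫ s in (-1 : ℝ)..1, g a r (s : ℂ) =
      Complex.I * (∫ y in Ioi (0 : ℝ), g a r (((-1 : ℝ) : ℂ) + y * Complex.I)) -
      Complex.I * (∫ y in Ioi (0 : ℝ), g a r (((1 : ℝ) : ℂ) + y * Complex.I)) := by
  have hlim := (((bottom_tendsto a r ha hr).sub (top_tendsto a r hr)).add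
    ((vertical_tendsto a r 1 ha (by norm_num) hr).const_mul Complex.I)).sub
    ((vertical_tendsto a r (-1) ha (by norm_num) hr).const_mul Complex.I)
  have h0 : Tendsto (fun _ : ℝ => (0 : ℂ)) atTop (𝓝 0) := tendsto_const_nhds
  have := tendsto_nhds_unique (h0.congr' ?_) hlim
  · linear_combination -this
  · filter_upwards [eventually_ge_atTop 1] with T hT
    have hT0 : 0 < T⁻¹ := by positivity
    have key := Complex.integral_boundary_rect_eq_zero_of_differentiableOn (g a r)
      (⟨-1, T⁻¹⟩ : ℂ) (⟨1, T⟩ : ℂ) ?_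
    · simp only [smul_eq_mul] at key
      exact key.symm
    · intro z hz
      rw [Complex.mem_reProdIm, uIcc_of_le (by norm_num),
        uIcc_of_le ((inv_le_one_of_one_le₀ hT).trans hT)] at hz
      obtain ⟨⟨h1, h2⟩, h3, h4⟩ := hz
      simp only at h1 h2 h3 h4
      refine (g_diffAt a r ?_).differentiableWithinAt
      have hz := slit_of (s := z.re) (y := z.im) (by
        have : 0 < z.im ^ 2 := by have := hT0.trans_le h3; positivity
        nlinarith)
      rwa [Complex.re_add_im] at hz

lemma besselJ_formula (ν r : ℝ) (hν : 0 < ν) (hr : 1 ≤ r) :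
    besselJ ν r = ((r ^ (-(1 : ℝ) / 2) : ℝ) : ℂ) *
      (Complex.exp (Complex.I * (r : ℂ)) *
        ((-(((1 / 2) ^ ν / (Real.Gamma (ν + 1 / 2) * Real.Gamma (1 / 2)) : ℝ) : ℂ) * Complex.I) *
          F (-2 * (1 : ℝ) * Complex.I) (ν - 1 / 2) 0 r⁻¹) +
        Complex.exp (-(Complex.I * (r : ℂ))) *
        (((((1 / 2) ^ ν / (Real.Gamma (ν + 1 / 2) * Real.Gamma (1 / 2)) : ℝ) : ℂ) * Complex.I) *
          F (-2 * (-1 : ℝ) * Complex.I) (ν - 1 / 2) 0 r⁻¹)) := by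
  have hr0 : 0 < r := by linarith
  have hint : ∫ s in (-1 : ℝ)..1,
      Complex.exp (Complex.I * (s : ℂ) * (r : ℂ)) * (((1 - s ^ 2) ^ (ν - 1 / 2) : ℝ) : ℂ) =
      ∫ s in (-1 : ℝ)..1, g (ν - 1 / 2) r (s : ℂ) := by
    refine intervalIntegral.integral_congr fun s hs => ?_
    rw [uIcc_of_le (by norm_num)] at hs
    have : 0 ≤ 1 - s ^ 2 := by nlinarith [hs.1, hs.2]
    simp only [g]
    rw [Complex.ofReal_cpow this]
    push_cast
    rfl
  unfold besselJ
  rw [hint, contour _ r (by linarith) hr, g_vertical_integral _ r _ (by norm_num) hr,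
    g_vertical_integral _ r _ (by norm_num) hr]
  have e1 : (r / 2) ^ ν * r ^ (-(ν - 1 / 2) - 1) = r ^ (-(1 : ℝ) / 2) * (1 / 2) ^ ν := by
    rw [div_eq_mul_one_div, Real.mul_rpow hr0.le (by norm_num), mul_right_comm, ← Real.rpow_add hr0]
    congr 2
    ring
  have e2 : (((r / 2) ^ ν / (Real.Gamma (ν + 1 / 2) * Real.Gamma (1 / 2)) : ℝ) : ℂ) *
      ((r ^ (-(ν - 1 / 2) - 1) : ℝ) : ℂ) = ((r ^ (-(1 : ℝ) / 2) : ℝ) : ℂ) *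
      (((1 / 2) ^ ν / (Real.Gamma (ν + 1 / 2) * Real.Gamma (1 / 2)) : ℝ) : ℂ) := by
    rw [← Complex.ofReal_mul, ← Complex.ofReal_mul, div_mul_eq_mul_div, e1, mul_div_assoc]
  have e3 : Complex.I * ((-1 : ℝ) : ℂ) * r = -(Complex.I * r) := by push_cast; ring
  have e4 : Complex.I * ((1 : ℝ) : ℂ) * r = Complex.I * r := by push_cast; ring
  rw [e3, e4]
  linear_combination (Complex.I * Complex.exp (-(Complex.I * r)) *
      F (-2 * (-1 : ℝ) * Complex.I) (ν - 1 / 2) 0 r⁻¹ - Complex.I * Complex.exp (Complex.I * r) *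
      F (-2 * (1 : ℝ) * Complex.I) (ν - 1 / 2) 0 r⁻¹) * e2

end BesselAux

/-- For every `ν > 0` there are smooth functions `j₊, j₋` on `[1,∞)` with
`J_ν(r) = r^{-1/2} (e^{ir} j₊(r) + e^{-ir} j₋(r))` for `r ≥ 1`, with
`|j₊(r)|, |j₋(r)| ≤ C_{ν,0}` and `|(d/dr)^N j_±(r)| ≤ C_{ν,N} r^{-N-1}` for `N ≥ 1, r ≥ 1`. -/
theorem besselJ_oscillatory_decomposition (ν : ℝ) (hν : 0 < ν) :
    ∃ jp jm : ℝ → ℂ,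
      ContDiffOn ℝ (⊤ : ℕ∞) jp (Set.Ici 1) ∧ ContDiffOn ℝ (⊤ : ℕ∞) jm (Set.Ici 1) ∧
      (∀ r : ℝ, 1 ≤ r →
        besselJ ν r = ((r ^ (-(1 : ℝ) / 2) : ℝ) : ℂ) *
          (Complex.exp (Complex.I * (r : ℂ)) * jp r +
            Complex.exp (-(Complex.I * (r : ℂ))) * jm r)) ∧
      ∃ C : ℕ → ℝ, (∀ N : ℕ, 0 < C N) ∧
        (∀ r : ℝ, 1 ≤ r → ‖jp r‖ ≤ C 0 ∧ ‖jm r‖ ≤ C 0) ∧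
        (∀ N : ℕ, 1 ≤ N → ∀ r : ℝ, 1 ≤ r →
          ‖iteratedDerivWithin N jp (Set.Ici 1) r‖ ≤ C N * r ^ (-(N : ℝ) - 1) ∧
          ‖iteratedDerivWithin N jm (Set.Ici 1) r‖ ≤ C N * r ^ (-(N : ℝ) - 1)) := by
  have ha : -1 < ν - 1 / 2 := by linarith
  have hp := (contDiff_const (c := (-(((1 / 2) ^ ν / (Real.Gamma (ν + 1 / 2) * Real.Gamma (1 / 2)) : ℝ) : ℂ) * Complex.I))).mul
    (BesselAux.F_contDiff (-2 * (1 : ℝ) * Complex.I)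
    (BesselAux.im_cond 1 (by norm_num)) (ν - 1 / 2) ha)
  have hm := (contDiff_const (c := ((((1 / 2) ^ ν / (Real.Gamma (ν + 1 / 2) * Real.Gamma (1 / 2)) : ℝ) : ℂ) * Complex.I))).mul
    (BesselAux.F_contDiff (-2 * (-1 : ℝ) * Complex.I)
    (BesselAux.im_cond (-1) (by norm_num)) (ν - 1 / 2) ha)
  obtain ⟨C₁, hC₁, hb₁, hd₁⟩ := BesselAux.comp_bounds _ hp
  obtain ⟨C₂, hC₂, hb₂, hd₂⟩ := BesselAux.comp_bounds _ hm
  refine ⟨_, _, BesselAux.comp_contDiffOn _ hp, BesselAux.comp_contDiffOn _ hm,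
    fun r hr => BesselAux.besselJ_formula ν r hν hr, fun N => max (C₁ N) (C₂ N),
    fun N => lt_max_of_lt_left (hC₁ N), fun r hr => ⟨(hb₁ r hr).trans (le_max_left _ _),
      (hb₂ r hr).trans (le_max_right _ _)⟩, fun N hN r hr => ?_⟩
  have hr0 : (0:ℝ) ≤ r ^ (-(N : ℝ) - 1) := Real.rpow_nonneg (by linarith) _
  exact ⟨(hd₁ N hN r hr).trans (mul_le_mul_of_nonneg_right (le_max_left _ _) hr0),
    (hd₂ N hN r hr).trans (mul_le_mul_of_nonneg_right (le_max_right _ _) hr0)⟩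
end

section
/- Let n ≥ 3 be an integer. There exist constants R₀ ≥ 1 and, for the given bump φ, a constant C such that for every measurable function R : [0,π] → ℂ with |R(s)| ≤ 1 for all s, all r₁, r₂ ≥ R₀ and all t ∈ ℝ: (r₁r₂)^{-(n-2)/2} · | ∫_0^π W(t, 𝐦_s) R(s) ds | ≤ C (1+|t|)^{-(n-1)/2}. -/
open MeasureTheory

/-- `W(t,v) = ∫_{ℝ²} φ(|ξ|) e^{i(t|ξ| − v·ξ)} dξ`. -/
noncomputable def Wfun (φ : ℝ → ℝ) (t : ℝ) (v : EuclideanSpace ℝ (Fin 2)) : ℂ :=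
  ∫ ξ : EuclideanSpace ℝ (Fin 2),
    (φ ‖ξ‖ : ℂ) * Complex.exp (Complex.I * ((t * ‖ξ‖ - @inner ℝ _ _ v ξ : ℝ) : ℂ))

/-- `𝐦_s = (r₁−r₂, √(2(1−cos s) r₁ r₂))`, so `‖𝐦_s‖ = √(r₁²+r₂²−2r₁r₂cos s)`. -/
noncomputable def mVec (r₁ r₂ s : ℝ) : EuclideanSpace ℝ (Fin 2) :=
  (WithLp.equiv 2 (Fin 2 → ℝ)).symm ![r₁ - r₂, Real.sqrt (2 * (1 - Real.cos s) * r₁ * r₂)]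


lemma aux_mid (l δ : ℝ) (hl : 0 < l) (hδ : 0 < δ) (hδ1 : δ ≤ 1) :
    ‖∫ θ in δ..(Real.pi - δ), Complex.exp (Complex.I * ((l * Real.cos θ : ℝ) : ℂ))‖
      ≤ 4 / (l * Real.sin δ) := by
  have hpi := Real.pi_gt_three
  have hle : δ ≤ Real.pi - δ := by linarith
  have hsin : ∀ x ∈ Set.uIcc δ (Real.pi - δ), 0 < Real.sin x := by
    intro x hx
    rw [Set.uIcc_of_le hle] at hx
    exact Real.sin_pos_of_pos_of_lt_pi (by linarith [hx.1]) (by linarith [hx.2])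
  have hsδ : 0 < Real.sin δ := hsin δ Set.left_mem_uIcc
  have hu : ∀ x ∈ Set.uIcc δ (Real.pi - δ),
      HasDerivAt (fun θ : ℝ => (((Real.sin θ)⁻¹ : ℝ) : ℂ))
        ((-Real.cos x / Real.sin x ^ 2 : ℝ) : ℂ) x := by
    intro x hx
    exact ((Real.hasDerivAt_sin x).inv (hsin x hx).ne').ofReal_comp
  have hv : ∀ x ∈ Set.uIcc δ (Real.pi - δ),
      HasDerivAt (fun θ : ℝ => Complex.exp (Complex.I * ((l * Real.cos θ : ℝ) : ℂ)))
        (Complex.exp (Complex.I * ((l * Real.cos x : ℝ) : ℂ)) *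
          (Complex.I * ((l * -Real.sin x : ℝ) : ℂ))) x := by
    intro x hx
    exact ((((Real.hasDerivAt_cos x).const_mul l).ofReal_comp).const_mul Complex.I).cexp
  have hcu : ContinuousOn (fun x : ℝ => ((-Real.cos x / Real.sin x ^ 2 : ℝ) : ℂ))
      (Set.uIcc δ (Real.pi - δ)) := by
    apply Complex.continuous_ofReal.comp_continuousOn
    apply ContinuousOn.div (by fun_prop) (by fun_prop)
    intro x hx
    have := hsin x hx
    positivity
  have hcs : ContinuousOn (fun x : ℝ => (1 / Real.sin x ^ 2 : ℝ))
      (Set.uIcc δ (Real.pi - δ)) := by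
    apply ContinuousOn.div (by fun_prop) (by fun_prop)
    intro x hx
    have := hsin x hx
    positivity
  have hnorm : ∀ y : ℝ, ‖Complex.exp (Complex.I * (y : ℂ))‖ = 1 := by
    intro y
    rw [mul_comm]; exact Complex.norm_exp_ofReal_mul_I y
  have key := intervalIntegral.integral_mul_deriv_eq_deriv_mul hu hv
    hcu.intervalIntegrable (Continuous.intervalIntegrable (by fun_prop) _ _)
  have hlhs : (∫ x in δ..(Real.pi - δ), (((Real.sin x)⁻¹ : ℝ) : ℂ) *
      (Complex.exp (Complex.I * ((l * Real.cos x : ℝ) : ℂ)) *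
          (Complex.I * ((l * -Real.sin x : ℝ) : ℂ)))) =
      (-Complex.I * (l : ℂ)) * ∫ x in δ..(Real.pi - δ),
        Complex.exp (Complex.I * ((l * Real.cos x : ℝ) : ℂ)) := by
    rw [← intervalIntegral.integral_const_mul]
    apply intervalIntegral.integral_congr
    intro x hx
    have h0 : (Real.sin x : ℂ) ≠ 0 := by exact_mod_cast (hsin x hx).ne'
    simp only [Complex.ofReal_inv, Complex.ofReal_mul, Complex.ofReal_neg]
    field_simp
  rw [hlhs] at key
  have hI : ‖∫ x in δ..(Real.pi - δ), ((-Real.cos x / Real.sin x ^ 2 : ℝ) : ℂ) *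
      Complex.exp (Complex.I * ((l * Real.cos x : ℝ) : ℂ))‖ ≤ 2 / Real.sin δ := by
    have h1 : ‖∫ x in δ..(Real.pi - δ), ((-Real.cos x / Real.sin x ^ 2 : ℝ) : ℂ) *
        Complex.exp (Complex.I * ((l * Real.cos x : ℝ) : ℂ))‖ ≤
        ∫ x in δ..(Real.pi - δ), 1 / Real.sin x ^ 2 := by
      apply intervalIntegral.norm_integral_le_of_norm_le hle
      · filter_upwards with x hx
        have := hsin x (by rw [Set.uIcc_of_le hle]; exact Set.Ioc_subset_Icc_self hx)
        rw [norm_mul, hnorm, mul_one, Complex.norm_real, Real.norm_eq_abs, abs_div, abs_neg,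
          abs_of_pos (pow_pos this 2)]
        gcongr
        exact Real.abs_cos_le_one x
      · exact hcs.intervalIntegrable
    have h2 : ∫ x in δ..(Real.pi - δ), 1 / Real.sin x ^ 2 =
        (-(Real.cos (Real.pi - δ) / Real.sin (Real.pi - δ))) - (-(Real.cos δ / Real.sin δ)) := by
      apply intervalIntegral.integral_eq_sub_of_hasDerivAt (f := fun x => -(Real.cos x / Real.sin x))
      · intro x hx
        have := hsin x hx
        have h := ((Real.hasDerivAt_cos x).div (Real.hasDerivAt_sin x) this.ne').neg
        refine h.congr_deriv ?_
        rw [← neg_div]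
        congr 1
        linarith [Real.sin_sq_add_cos_sq x]
      · exact hcs.intervalIntegrable
    rw [h2, Real.cos_pi_sub, Real.sin_pi_sub] at h1
    refine h1.trans ?_
    rw [le_div_iff₀ hsδ]
    have : (-(-Real.cos δ / Real.sin δ) - -(Real.cos δ / Real.sin δ)) * Real.sin δ
      = 2 * Real.cos δ := by field_simp; ring
    rw [this]
    linarith [Real.cos_le_one δ]
  have hB : ‖(-Complex.I * (l : ℂ)) * ∫ x in δ..(Real.pi - δ),
        Complex.exp (Complex.I * ((l * Real.cos x : ℝ) : ℂ))‖ ≤ 4 / Real.sin δ := by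
    rw [key]
    refine (norm_sub_le _ _).trans ?_
    have h3 := norm_sub_le ((((Real.sin (Real.pi - δ))⁻¹ : ℝ) : ℂ) *
      Complex.exp (Complex.I * ((l * Real.cos (Real.pi - δ) : ℝ) : ℂ)))
      ((((Real.sin δ)⁻¹ : ℝ) : ℂ) * Complex.exp (Complex.I * ((l * Real.cos δ : ℝ) : ℂ)))
    rw [norm_mul, norm_mul, hnorm, hnorm, Complex.norm_real, Complex.norm_real, Real.sin_pi_sub,
      Real.norm_of_nonneg (by positivity)] at h3
    have h4 : 4 / Real.sin δ = (Real.sin δ)⁻¹ * 1 + (Real.sin δ)⁻¹ * 1 + 2 / Real.sin δ := by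
      field_simp; norm_num
    rw [h4]
    rw [Real.sin_pi_sub]
    exact add_le_add h3 hI
  rw [norm_mul, norm_mul, norm_neg, Complex.norm_I, one_mul, Complex.norm_real,
    Real.norm_of_nonneg hl.le] at hB
  rw [mul_comm l, ← div_div, le_div_iff₀ hl, mul_comm]
  exact hB

lemma aux_half (l : ℝ) (hl : 0 ≤ l) :
    ‖∫ θ in (0:ℝ)..Real.pi, Complex.exp (Complex.I * ((l * Real.cos θ : ℝ) : ℂ))‖
      ≤ 20 / Real.sqrt (1 + l) := by
  have hpi := Real.pi_gt_three
  have hpi4 := Real.pi_lt_d2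
  have hnorm : ∀ y : ℝ, ‖Complex.exp (Complex.I * (y : ℂ))‖ = 1 := by
    intro y
    rw [mul_comm]; exact Complex.norm_exp_ofReal_mul_I y
  have htriv : ∀ a b : ℝ,
      ‖∫ θ in a..b, Complex.exp (Complex.I * ((l * Real.cos θ : ℝ) : ℂ))‖ ≤ |b - a| := by
    intro a b
    have := intervalIntegral.norm_integral_le_of_norm_le_const (a := a) (b := b) (C := 1)
      (f := fun θ : ℝ => Complex.exp (Complex.I * ((l * Real.cos θ : ℝ) : ℂ)))
      (fun x _ => (hnorm _).le)
    simpa using this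
  set q := Real.sqrt (1 + l) with hq
  have hq2 : q ^ 2 = 1 + l := Real.sq_sqrt (by linarith)
  have hq0 : 0 < q := Real.sqrt_pos.2 (by linarith)
  have hq1 : 1 ≤ q := by nlinarith
  rcases lt_or_ge l 1 with h | h
  · refine (htriv _ _).trans ?_
    rw [sub_zero, abs_of_pos Real.pi_pos, le_div_iff₀ hq0]
    have : q ≤ 2 := by nlinarith
    nlinarith
  · have hδ : 0 < 1 / q := by positivity
    have hδ1 : 1 / q ≤ 1 := by rw [div_le_one hq0]; exact hq1
    have hmid := aux_mid l (1/q) (by linarith) hδ hδ1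
    have hs := Real.mul_le_sin hδ.le (by linarith)
    have hii : ∀ a b : ℝ, IntervalIntegrable
      (fun θ : ℝ => Complex.exp (Complex.I * ((l * Real.cos θ : ℝ) : ℂ))) volume a b := by
      intro a b
      exact Continuous.intervalIntegrable (by fun_prop) _ _
    rw [← intervalIntegral.integral_add_adjacent_intervals (hii 0 (Real.pi - 1/q)) (hii _ _),
      ← intervalIntegral.integral_add_adjacent_intervals (hii 0 (1/q)) (hii _ _)]
    refine (norm_add₃_le).trans ?_
    have h1 := htriv 0 (1/q)
    have h2 := htriv (Real.pi - 1/q) Real.pi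
    rw [sub_zero, abs_of_pos hδ] at h1
    rw [sub_sub_cancel, abs_of_pos hδ] at h2
    have h3 : 4 / (l * Real.sin (1/q)) ≤ 16 / q := by
      have hlow : (1:ℝ)/2 * (1/q) ≤ Real.sin (1/q) := by
        refine le_trans ?_ hs
        have hh : (1:ℝ) / 2 ≤ 2 / Real.pi := by
          rw [div_le_div_iff₀ (by norm_num) Real.pi_pos]; linarith
        gcongr
      have : 4 / (l * Real.sin (1/q)) ≤ 4 / ((q^2/2) * (1/2 * (1/q))) := by
        gcongr
        linarith
      refine this.trans (le_of_eq ?_)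
      field_simp
      norm_num
    calc _ ≤ 1/q + 16/q + 1/q := by
          gcongr
          exact hmid.trans h3
      _ ≤ 20/q := by rw [← add_div, ← add_div]; gcongr; norm_num

lemma aux_J (l α : ℝ) (hl : 0 ≤ l) :
    ‖∫ θ in Set.Ioo (-Real.pi) Real.pi,
      Complex.exp (Complex.I * ((-(l * Real.cos (θ - α)) : ℝ) : ℂ))‖
      ≤ 40 / Real.sqrt (1 + l) := by
  have hpi := Real.pi_pos
  set f : ℝ → ℂ := fun θ => Complex.exp (Complex.I * ((l * Real.cos θ : ℝ) : ℂ)) with hf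
  have hii : ∀ a b : ℝ, IntervalIntegrable f volume a b := by
    intro a b
    exact Continuous.intervalIntegrable (by fun_prop) _ _
  have hper : Function.Periodic f (2 * Real.pi) := by
    intro x
    simp only [hf, Real.cos_add_two_pi]
  have e1 : ∫ θ in Set.Ioo (-Real.pi) Real.pi,
      Complex.exp (Complex.I * ((-(l * Real.cos (θ - α)) : ℝ) : ℂ)) =
      ∫ θ in (-Real.pi)..Real.pi, f (θ - (α + Real.pi)) := by
    rw [← integral_Ioc_eq_integral_Ioo, ← intervalIntegral.integral_of_le (by linarith)]
    apply intervalIntegral.integral_congr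
    intro x _
    simp only [hf]
    rw [← sub_sub, Real.cos_sub_pi]
    simp
  have e2 : ∫ θ in (-Real.pi)..Real.pi, f (θ - (α + Real.pi)) =
      ∫ θ in (-Real.pi)..Real.pi, f θ := by
    rw [intervalIntegral.integral_comp_sub_right]
    have := hper.intervalIntegral_add_eq (-Real.pi - (α + Real.pi)) (-Real.pi)
    convert this using 2 <;> ring
  have e3 : ∫ θ in (-Real.pi)..0, f θ = ∫ θ in (0:ℝ)..Real.pi, f θ := by
    have := intervalIntegral.integral_comp_neg (a := 0) (b := Real.pi) f
    rw [neg_zero] at this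
    rw [← this]
    simp [hf]
  rw [e1, e2, ← intervalIntegral.integral_add_adjacent_intervals (hii _ 0) (hii _ _), e3]
  refine (norm_add_le _ _).trans ?_
  have := aux_half l hl
  have h4 : 40 / Real.sqrt (1 + l) = 20 / Real.sqrt (1 + l) + 20 / Real.sqrt (1 + l) := by ring
  rw [h4]
  exact add_le_add this this

/-- Amplitude in polar coordinates. -/
noncomputable def gAmp (φ : ℝ → ℝ) (ρ : ℝ) : ℂ := ((ρ * φ ρ : ℝ) : ℂ)

lemma aux_exists_angle (v : EuclideanSpace ℝ (Fin 2)) :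
    ∃ α : ℝ, ∀ θ : ℝ, v 0 * Real.cos θ + v 1 * Real.sin θ = ‖v‖ * Real.cos (θ - α) := by
  refine ⟨Complex.arg (Complex.orthonormalBasisOneI.repr.symm v), fun θ => ?_⟩
  set z := Complex.orthonormalBasisOneI.repr.symm v with hz
  have hn : ‖v‖ = ‖z‖ := by rw [hz, LinearIsometryEquiv.norm_map]
  have hre : z.re = v 0 := by rw [hz, Complex.orthonormalBasisOneI_repr_symm_apply]; simp
  have him : z.im = v 1 := by rw [hz, Complex.orthonormalBasisOneI_repr_symm_apply]; simp
  have h1 := Complex.norm_mul_cos_arg z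
  have h2 := Complex.norm_mul_sin_arg z
  rw [hn, Real.cos_sub, ← hre, ← him, ← h1, ← h2]
  ring_nf

lemma aux_polar (φ : ℝ → ℝ) (t : ℝ) (v : EuclideanSpace ℝ (Fin 2)) :
    ∃ α : ℝ, Wfun φ t v =
      ∫ p in (Set.Ioi (0:ℝ)) ×ˢ (Set.Ioo (-Real.pi) Real.pi),
        gAmp φ p.1 * Complex.exp (Complex.I *
          ((p.1 * (t - ‖v‖ * Real.cos (p.2 - α)) : ℝ) : ℂ)) := by
  obtain ⟨α, hα⟩ := aux_exists_angle v
  refine ⟨α, ?_⟩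
  unfold Wfun
  rw [← (Complex.orthonormalBasisOneI.measurePreserving_repr).integral_comp
    (Complex.orthonormalBasisOneI.repr.toHomeomorph.measurableEmbedding),
    ← Complex.integral_comp_polarCoord_symm]
  rw [show polarCoord.target = (Set.Ioi (0:ℝ)) ×ˢ (Set.Ioo (-Real.pi) Real.pi) from rfl]
  apply setIntegral_congr_fun (measurableSet_Ioi.prod measurableSet_Ioo)
  rintro ⟨ρ, θ⟩ ⟨hρ, -⟩
  have hρ : 0 < ρ := hρ
  have hnorm : ‖Complex.orthonormalBasisOneI.repr (Complex.polarCoord.symm (ρ, θ))‖ = ρ := by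
    rw [LinearIsometryEquiv.norm_map, Complex.norm_polarCoord_symm, abs_of_pos hρ]
  have hinner : inner ℝ v (Complex.orthonormalBasisOneI.repr (Complex.polarCoord.symm (ρ, θ)))
      = ρ * (‖v‖ * Real.cos (θ - α)) := by
    rw [← hα]
    simp [PiLp.inner_apply, Fin.sum_univ_two, Complex.orthonormalBasisOneI_repr_apply,
      Complex.polarCoord_symm_apply, -Complex.ofReal_cos, -Complex.ofReal_sin]
    ring
  simp only [gAmp, hnorm, hinner, Complex.real_smul]
  rw [Complex.ofReal_mul ρ, mul_assoc]
  congr 5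
  ring

lemma gAmp_zero (φ : ℝ → ℝ) (hφsupp : Function.support φ ⊆ Set.Icc 1 2) (ρ : ℝ)
    (h : ρ ∉ Set.Icc (1:ℝ) 2) : gAmp φ ρ = 0 := by
  have : φ ρ = 0 := by
    by_contra h'
    exact h (hφsupp h')
  simp [gAmp, this]

lemma gAmp_contDiff (φ : ℝ → ℝ) (hφ : ContDiff ℝ (⊤ : ℕ∞) φ) :
    ContDiff ℝ (⊤ : ℕ∞) (gAmp φ) :=
  Complex.ofRealCLM.contDiff.comp (contDiff_id.mul hφ)

lemma gAmp_compact (φ : ℝ → ℝ) (hφsupp : Function.support φ ⊆ Set.Icc 1 2) :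
    HasCompactSupport (gAmp φ) :=
  HasCompactSupport.intro isCompact_Icc (fun x hx => gAmp_zero φ hφsupp x hx)

lemma aux_integrableOn (φ : ℝ → ℝ) (hφ : ContDiff ℝ (⊤ : ℕ∞) φ)
    (hφsupp : Function.support φ ⊆ Set.Icc 1 2) (t r α : ℝ) :
    IntegrableOn (fun p : ℝ × ℝ => gAmp φ p.1 * Complex.exp (Complex.I *
          ((p.1 * (t - r * Real.cos (p.2 - α)) : ℝ) : ℂ)))
      ((Set.Ioi (0:ℝ)) ×ˢ (Set.Ioo (-Real.pi) Real.pi)) := by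
  have hg := (gAmp_contDiff φ hφ).continuous
  have h1 : IntegrableOn (fun p : ℝ × ℝ => gAmp φ p.1 * Complex.exp (Complex.I *
          ((p.1 * (t - r * Real.cos (p.2 - α)) : ℝ) : ℂ)))
      ((Set.Icc (1:ℝ) 2) ×ˢ (Set.Icc (-Real.pi) Real.pi)) := by
    apply ContinuousOn.integrableOn_compact (isCompact_Icc.prod isCompact_Icc)
    apply Continuous.continuousOn
    fun_prop
  refine h1.of_forall_sdiff_eq_zero (measurableSet_Ioi.prod measurableSet_Ioo) ?_
  rintro ⟨ρ, θ⟩ ⟨⟨_, h2⟩, h3⟩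
  have : ρ ∉ Set.Icc (1:ℝ) 2 := fun h => h3 ⟨h, Set.Ioo_subset_Icc_self h2⟩
  simp [gAmp_zero φ hφsupp ρ this]

lemma aux_fourier (φ : ℝ → ℝ) (hφ : ContDiff ℝ (⊤ : ℕ∞) φ)
    (hφsupp : Function.support φ ⊆ Set.Icc 1 2) (n : ℕ) :
    ∃ C : ℝ, 0 < C ∧ ∀ s : ℝ, (1 + |s|) ^ n *
      ‖∫ ρ in Set.Ioi (0:ℝ), gAmp φ ρ * Complex.exp (Complex.I * ((ρ * s : ℝ) : ℂ))‖ ≤ C := by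
  set G : SchwartzMap ℝ ℂ := (gAmp_compact φ hφsupp).toSchwartzMap (gAmp_contDiff φ hφ) with hG
  set F : SchwartzMap ℝ ℂ := FourierTransform.fourier G with hF
  set B := 2 ^ n * (Finset.Iic (n, 0)).sup (fun m => SchwartzMap.seminorm ℝ m.1 m.2) F with hB
  have hb : ∀ x : ℝ, (1 + |x|) ^ n * ‖F x‖ ≤ B := by
    intro x
    have := SchwartzMap.one_add_le_sup_seminorm_apply (𝕜 := ℝ) (m := (n, 0)) (k := n) (n := 0)
      le_rfl le_rfl F x
    simpa using this
  have hB0 : 0 ≤ B := le_trans (by positivity) (hb 0)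
  have hpi := Real.pi_gt_three
  refine ⟨(2 * Real.pi) ^ n * (B + 1), by positivity, fun s => ?_⟩
  have e : ∫ ρ in Set.Ioi (0:ℝ), gAmp φ ρ * Complex.exp (Complex.I * ((ρ * s : ℝ) : ℂ)) =
      F (-s / (2 * Real.pi)) := by
    rw [setIntegral_eq_integral_of_forall_compl_eq_zero]
    · rw [hF, SchwartzMap.fourier_coe, Real.fourier_real_eq_integral_exp_smul]
      congr 1
      ext ρ
      rw [smul_eq_mul, mul_comm, mul_comm Complex.I]
      congr 4
      field_simp
    · intro x hx
      rw [gAmp_zero φ hφsupp x, zero_mul]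
      intro h
      exact hx (lt_of_lt_of_le one_pos h.1)
  rw [e]
  have h1 : 1 + |s| ≤ 2 * Real.pi * (1 + |(-s / (2 * Real.pi))|) := by
    rw [abs_div, abs_neg, abs_of_pos (by positivity : 0 < 2 * Real.pi)]
    have : 2 * Real.pi * (1 + |s| / (2 * Real.pi)) = 2 * Real.pi + |s| := by field_simp
    rw [this]; linarith
  calc _ ≤ (2 * Real.pi * (1 + |(-s / (2 * Real.pi))|)) ^ n * ‖F (-s / (2 * Real.pi))‖ := by gcongr
    _ = (2 * Real.pi) ^ n * ((1 + |(-s / (2 * Real.pi))|) ^ n * ‖F (-s / (2 * Real.pi))‖) := by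
      rw [mul_pow]; ring
    _ ≤ (2 * Real.pi) ^ n * (B + 1) := by
      gcongr
      linarith [hb (-s / (2 * Real.pi))]

lemma W_far (φ : ℝ → ℝ) (hφ : ContDiff ℝ (⊤ : ℕ∞) φ)
    (hφsupp : Function.support φ ⊆ Set.Icc 1 2) (n : ℕ) :
    ∃ C : ℝ, 0 < C ∧ ∀ (t : ℝ) (v : EuclideanSpace ℝ (Fin 2)), 2 * ‖v‖ ≤ |t| →
      ‖Wfun φ t v‖ ≤ C / (1 + |t|) ^ n := by
  obtain ⟨C, hC, h⟩ := aux_fourier φ hφ hφsupp n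
  have hpi := Real.pi_pos
  refine ⟨2 ^ n * C * (2 * Real.pi), by positivity, fun t v hv => ?_⟩
  obtain ⟨α, hα⟩ := aux_polar φ t v
  have hint := aux_integrableOn φ hφ hφsupp t ‖v‖ α
  rw [hα, Measure.volume_eq_prod, ← Measure.prod_restrict, integral_prod_symm]
  swap
  · rw [Measure.prod_restrict]; exact hint
  have hb : ∀ θ ∈ Set.Ioo (-Real.pi) Real.pi, ‖∫ ρ in Set.Ioi (0:ℝ),
      gAmp φ ρ * Complex.exp (Complex.I *
          ((ρ * (t - ‖v‖ * Real.cos (θ - α)) : ℝ) : ℂ))‖ ≤ 2 ^ n * C / (1 + |t|) ^ n := by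
    intro θ _
    set s := t - ‖v‖ * Real.cos (θ - α) with hs
    have h1 := h s
    have h2 : 1 + |t| ≤ 2 * (1 + |s|) := by
      have h3 : |t| ≤ |s| + |‖v‖ * Real.cos (θ - α)| := by
        have := abs_add_le s (‖v‖ * Real.cos (θ - α))
        rwa [hs, sub_add_cancel] at this
      have h4 : |‖v‖ * Real.cos (θ - α)| ≤ ‖v‖ := by
        rw [abs_mul, abs_norm]
        exact mul_le_of_le_one_right (norm_nonneg _) (Real.abs_cos_le_one _)
      linarith
    rw [le_div_iff₀ (by positivity)]
    calc _ ≤ ‖∫ ρ in Set.Ioi (0:ℝ),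
      gAmp φ ρ * Complex.exp (Complex.I * ((ρ * s : ℝ) : ℂ))‖ * (2 * (1 + |s|)) ^ n := by gcongr
      _ = 2 ^ n * ((1 + |s|) ^ n * ‖∫ ρ in Set.Ioi (0:ℝ),
      gAmp φ ρ * Complex.exp (Complex.I * ((ρ * s : ℝ) : ℂ))‖) := by rw [mul_pow]; ring
      _ ≤ _ := by gcongr
  have := norm_setIntegral_le_of_norm_le_const (μ := volume) measure_Ioo_lt_top hb
  refine this.trans (le_of_eq ?_)
  rw [Real.volume_real_Ioo_of_le (by linarith)]
  ring

lemma W_near (φ : ℝ → ℝ) (hφ : ContDiff ℝ (⊤ : ℕ∞) φ)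
    (hφsupp : Function.support φ ⊆ Set.Icc 1 2) :
    ∃ C : ℝ, 0 < C ∧ ∀ (t : ℝ) (v : EuclideanSpace ℝ (Fin 2)),
      ‖Wfun φ t v‖ ≤ C / Real.sqrt (1 + ‖v‖) := by
  have hg := (gAmp_contDiff φ hφ).continuous
  have hgi : Integrable (gAmp φ) := hg.integrable_of_hasCompactSupport (gAmp_compact φ hφsupp)
  have hI0 : 0 ≤ ∫ ρ in Set.Ioi (0:ℝ), ‖gAmp φ ρ‖ := integral_nonneg (fun _ => norm_nonneg _)
  refine ⟨40 * ((∫ ρ in Set.Ioi (0:ℝ), ‖gAmp φ ρ‖) + 1), by positivity, fun t v => ?_⟩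
  obtain ⟨α, hα⟩ := aux_polar φ t v
  have hint := aux_integrableOn φ hφ hφsupp t ‖v‖ α
  have hq : 0 < Real.sqrt (1 + ‖v‖) := Real.sqrt_pos.2 (by positivity)
  rw [hα, Measure.volume_eq_prod, setIntegral_prod _ hint]
  have : ‖∫ ρ in Set.Ioi (0:ℝ), ∫ θ in Set.Ioo (-Real.pi) Real.pi, gAmp φ ρ * Complex.exp (Complex.I *
          ((ρ * (t - ‖v‖ * Real.cos (θ - α)) : ℝ) : ℂ))‖ ≤
      ∫ ρ in Set.Ioi (0:ℝ), ‖gAmp φ ρ‖ * (40 / Real.sqrt (1 + ‖v‖)) := by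
    apply norm_integral_le_of_norm_le
    · exact (hgi.norm.mul_const _).integrableOn
    · filter_upwards with ρ
      by_cases hρ : ρ ∈ Set.Icc (1:ℝ) 2
      · have e : ∀ θ : ℝ, gAmp φ ρ * Complex.exp (Complex.I *
            ((ρ * (t - ‖v‖ * Real.cos (θ - α)) : ℝ) : ℂ)) =
            (gAmp φ ρ * Complex.exp (((ρ * t : ℝ) : ℂ) * Complex.I)) *
              Complex.exp (Complex.I * ((-((ρ * ‖v‖) * Real.cos (θ - α)) : ℝ) : ℂ)) := by
          intro θ
          rw [mul_assoc, ← Complex.exp_add]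
          congr 2
          push_cast
          ring
        simp_rw [e]
        rw [integral_const_mul, norm_mul, norm_mul, Complex.norm_exp_ofReal_mul_I, mul_one]
        have hr : ‖v‖ ≤ ρ * ‖v‖ := le_mul_of_one_le_left (norm_nonneg _) hρ.1
        gcongr
        refine (aux_J (ρ * ‖v‖) α ((norm_nonneg _).trans hr)).trans ?_
        gcongr
      · simp [gAmp_zero φ hφsupp ρ hρ]
  refine this.trans ?_
  rw [integral_mul_const, mul_div_assoc', mul_comm]
  gcongr
  linarith

lemma mVec_norm_le (r₁ r₂ s : ℝ) (h₁ : 0 ≤ r₁) (h₂ : 0 ≤ r₂) : ‖mVec r₁ r₂ s‖ ≤ r₁ + r₂ := by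
  have h12 : 0 ≤ r₁ * r₂ := mul_nonneg h₁ h₂
  have h0 : 0 ≤ 2 * (1 - Real.cos s) * r₁ * r₂ := by
    have := Real.cos_le_one s
    rw [mul_assoc]
    exact mul_nonneg (by linarith) h12
  rw [EuclideanSpace.norm_eq, Fin.sum_univ_two]
  apply Real.sqrt_le_iff.2
  refine ⟨by positivity, ?_⟩
  simp only [mVec, WithLp.equiv_symm_apply, Matrix.cons_val_zero, Matrix.cons_val_one,
    Real.norm_eq_abs, sq_abs]
  rw [Real.sq_sqrt h0]
  nlinarith [Real.neg_one_le_cos s]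

lemma W_disp (φ : ℝ → ℝ) (hφ : ContDiff ℝ (⊤ : ℕ∞) φ)
    (hφsupp : Function.support φ ⊆ Set.Icc 1 2) :
    ∃ C : ℝ, 0 < C ∧ ∀ (t : ℝ) (v : EuclideanSpace ℝ (Fin 2)),
      ‖Wfun φ t v‖ ≤ C * (1 + |t|) ^ (-(1:ℝ) / 2) := by
  obtain ⟨C₁, hC₁, h₁⟩ := W_far φ hφ hφsupp 1
  obtain ⟨C₂, hC₂, h₂⟩ := W_near φ hφ hφsupp
  refine ⟨C₁ + 2 * C₂, by positivity, fun t v => ?_⟩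
  have hX : 1 ≤ 1 + |t| := by linarith [abs_nonneg t]
  have e : (1 + |t|) ^ (-(1:ℝ) / 2) = 1 / Real.sqrt (1 + |t|) := by
    rw [neg_div, Real.rpow_neg (by linarith), Real.sqrt_eq_rpow, one_div, one_div]
  set q := Real.sqrt (1 + |t|) with hq
  have hq2 : q ^ 2 = 1 + |t| := Real.sq_sqrt (by linarith)
  have hq0 : 0 < q := Real.sqrt_pos.2 (by linarith)
  have hq1 : 1 ≤ q := by nlinarith
  rw [e, mul_one_div, add_div]
  have p1 : 0 < C₁ / q := by positivity
  have p2 : 0 < 2 * C₂ / q := by positivity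
  rcases le_or_gt (2 * ‖v‖) |t| with h | h
  · have h3 : C₁ / (1 + |t|) ^ 1 ≤ C₁ / q := by
      rw [pow_one, ← hq2]
      gcongr
      nlinarith
    linarith [h₁ t v h]
  · have h3 : C₂ / Real.sqrt (1 + ‖v‖) ≤ 2 * C₂ / q := by
      have h4 : q / 2 ≤ Real.sqrt (1 + ‖v‖) := by
        apply Real.le_sqrt_of_sq_le
        rw [div_pow, hq2]
        linarith [norm_nonneg v]
      calc C₂ / Real.sqrt (1 + ‖v‖) ≤ C₂ / (q / 2) := by gcongr
        _ = 2 * C₂ / q := by field_simp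
    linarith [h₂ t v]

/-- Estimate on the contribution of the smooth remainder of the Hadamard parametrix:
for `n ≥ 3` there are `R₀ ≥ 1` and `C` such that for every measurable `R` with `|R(s)| ≤ 1`,
all `r₁, r₂ ≥ R₀` and all `t ∈ ℝ`,
`(r₁r₂)^{-(n-2)/2} |∫_0^π W(t,𝐦_s) R(s) ds| ≤ C (1+|t|)^{-(n-1)/2}`. -/
theorem remainder_term_estimate (n : ℕ) (hn : 3 ≤ n)
    (φ : ℝ → ℝ) (hφ : ContDiff ℝ (⊤ : ℕ∞) φ) (hφsupp : Function.support φ ⊆ Set.Icc 1 2) :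
    ∃ R₀ C : ℝ, 1 ≤ R₀ ∧ 0 < C ∧
      ∀ R : ℝ → ℂ, Measurable R → (∀ s : ℝ, ‖R s‖ ≤ 1) →
      ∀ r₁ r₂ t : ℝ, R₀ ≤ r₁ → R₀ ≤ r₂ →
        (r₁ * r₂) ^ (-((n : ℝ) - 2) / 2) *
            ‖∫ s in (0 : ℝ)..Real.pi, Wfun φ t (mVec r₁ r₂ s) * R s‖ ≤
          C * (1 + |t|) ^ (-((n : ℝ) - 1) / 2) := by
  obtain ⟨C₁, hC₁, h₁⟩ := W_far φ hφ hφsupp n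
  obtain ⟨C₂, hC₂, h₂⟩ := W_disp φ hφ hφsupp
  have hpi := Real.pi_pos
  have hn3 : (3:ℝ) ≤ n := by exact_mod_cast hn
  refine ⟨1, Real.pi * C₁ + 5 ^ (((n:ℝ) - 2) / 2) * (Real.pi * C₂), le_rfl, by positivity, ?_⟩
  intro R _ hR r₁ r₂ t hr₁ hr₂
  have hX : 1 ≤ 1 + |t| := by linarith [abs_nonneg t]
  set X := 1 + |t| with hXdef
  have hX0 : 0 < X := by linarith
  have hrr : 1 ≤ r₁ * r₂ := by nlinarith
  have hbound : ∀ B : ℝ, (∀ s, ‖Wfun φ t (mVec r₁ r₂ s)‖ ≤ B) →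
      ‖∫ s in (0 : ℝ)..Real.pi, Wfun φ t (mVec r₁ r₂ s) * R s‖ ≤ Real.pi * B := by
    intro B hB
    have := intervalIntegral.norm_integral_le_of_norm_le_const (a := 0) (b := Real.pi) (C := B)
      (f := fun s => Wfun φ t (mVec r₁ r₂ s) * R s) (fun s _ => by
        rw [norm_mul]
        calc _ ≤ ‖Wfun φ t (mVec r₁ r₂ s)‖ * 1 := by gcongr; exact hR s
          _ ≤ B := by rw [mul_one]; exact hB s)
    rwa [sub_zero, abs_of_pos hpi, mul_comm] at this
  have hY : 0 < X ^ (-((n : ℝ) - 1) / 2) := by positivity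
  rw [add_mul]
  have q1 : 0 ≤ Real.pi * C₁ * X ^ (-((n : ℝ) - 1) / 2) := by positivity
  have q2 : 0 ≤ 5 ^ (((n:ℝ) - 2) / 2) * (Real.pi * C₂) * X ^ (-((n : ℝ) - 1) / 2) := by positivity
  rcases le_or_gt (2 * (r₁ + r₂)) |t| with h | h
  · have hI := hbound (C₁ / X ^ n) (fun s => h₁ t _ (by
      have := mVec_norm_le r₁ r₂ s (by linarith) (by linarith)
      linarith))
    have hle1 : (r₁ * r₂) ^ (-((n : ℝ) - 2) / 2) ≤ 1 :=
      Real.rpow_le_one_of_one_le_of_nonpos hrr (by linarith)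
    have hpow : C₁ / X ^ n ≤ C₁ * X ^ (-((n : ℝ) - 1) / 2) := by
      rw [div_eq_mul_inv, ← Real.rpow_natCast, ← Real.rpow_neg hX0.le]
      gcongr
      linarith
    calc _ ≤ 1 * (Real.pi * (C₁ / X ^ n)) := by gcongr
      _ ≤ 1 * (Real.pi * (C₁ * X ^ (-((n : ℝ) - 1) / 2))) := by gcongr
      _ = Real.pi * C₁ * X ^ (-((n : ℝ) - 1) / 2) := by ring
      _ ≤ _ := by linarith
  · have hI := hbound _ (fun s => h₂ t (mVec r₁ r₂ s))
    have hX5 : X / 5 ≤ r₁ * r₂ := by nlinarith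
    have hle : (r₁ * r₂) ^ (-((n : ℝ) - 2) / 2) ≤
        5 ^ (((n:ℝ) - 2) / 2) * X ^ (-((n : ℝ) - 2) / 2) := by
      have a1 : (r₁ * r₂) ^ (-((n : ℝ) - 2) / 2) ≤ (X / 5) ^ (-((n : ℝ) - 2) / 2) :=
        Real.rpow_le_rpow_of_nonpos (by positivity) hX5 (by linarith)
      refine a1.trans (le_of_eq ?_)
      rw [Real.div_rpow hX0.le (by norm_num), neg_div, Real.rpow_neg (by norm_num : (0:ℝ) ≤ 5),
        div_inv_eq_mul, mul_comm]
    have hexp : X ^ (-((n : ℝ) - 2) / 2) * X ^ (-(1:ℝ) / 2) = X ^ (-((n : ℝ) - 1) / 2) := by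
      rw [← Real.rpow_add hX0]
      congr 1
      ring
    calc _ ≤ (5 ^ (((n:ℝ) - 2) / 2) * X ^ (-((n : ℝ) - 2) / 2)) *
          (Real.pi * (C₂ * X ^ (-(1:ℝ) / 2))) := by gcongr
      _ = 5 ^ (((n:ℝ) - 2) / 2) * (Real.pi * C₂) *
          (X ^ (-((n : ℝ) - 2) / 2) * X ^ (-(1:ℝ) / 2)) := by ring
      _ = 5 ^ (((n:ℝ) - 2) / 2) * (Real.pi * C₂) * X ^ (-((n : ℝ) - 1) / 2) := by rw [hexp]
      _ ≤ _ := by linarith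
end

section
/- Let ν > 0 and N ∈ ℕ, and let φ : ℝ → ℂ be smooth with support contained in [1/2, 2]. There exists a constant C depending only on ν, N and φ such that for all r₁, r₂ ∈ (0,1] and all t ∈ ℝ with |t| ≥ 1: | ∫_0^∞ e^{itρ} J_ν(r₁ρ) J_ν(r₂ρ) φ(ρ) ρ dρ | ≤ C (r₁r₂)^ν |t|^{-N}. -/
open MeasureTheory

open FourierTransform

lemma fourier_decay (ψ : ℝ → ℂ) (h1 : HasCompactSupport ψ) (h2 : ContDiff ℝ (⊤ : ℕ∞) ψ) (N : ℕ) :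
    ∃ C : ℝ, 0 ≤ C ∧ ∀ τ : ℝ, (1 + |τ|) ^ N *
      ‖∫ ρ : ℝ, Complex.exp (Complex.I * (τ : ℂ) * (ρ : ℂ)) * ψ ρ‖ ≤ C := by
  let f : SchwartzMap ℝ ℂ := h1.toSchwartzMap h2
  have hf : (f : ℝ → ℂ) = ψ := by ext x; rfl
  let C0 : ℝ := 2 ^ N * (Finset.Iic ((N, 0) : ℕ × ℕ)).sup
    (fun m => SchwartzMap.seminorm ℝ m.1 m.2) (𝓕 f)
  have hC0 : ∀ x : ℝ, (1 + ‖x‖) ^ N * ‖(𝓕 f) x‖ ≤ C0 := by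
    intro x
    have := SchwartzMap.one_add_le_sup_seminorm_apply (𝕜 := ℝ) (m := ((N, 0) : ℕ × ℕ))
      (k := N) (n := 0) le_rfl le_rfl (𝓕 f) x
    simpa [C0] using this
  have hpos : 0 ≤ C0 := le_trans (by positivity) (hC0 0)
  refine ⟨(2 * Real.pi) ^ N * C0, by positivity, fun τ => ?_⟩
  have h := hC0 (-τ / (2 * Real.pi))
  have e : (𝓕 f) (-τ / (2 * Real.pi)) =
      ∫ ρ : ℝ, Complex.exp (Complex.I * (τ : ℂ) * (ρ : ℂ)) * ψ ρ := by
    rw [SchwartzMap.fourier_coe, hf, Real.fourier_real_eq_integral_exp_smul]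
    congr 1 with v
    rw [smul_eq_mul]
    congr 2
    have : (Real.pi : ℂ) ≠ 0 := by exact_mod_cast Real.pi_ne_zero
    push_cast
    field_simp
  rw [e] at h
  have hpi : (1 : ℝ) ≤ 2 * Real.pi := by linarith [Real.pi_gt_three]
  have h3 : 1 + |τ| ≤ 2 * Real.pi * (1 + ‖-τ / (2 * Real.pi)‖) := by
    rw [Real.norm_eq_abs, abs_div, abs_neg, abs_of_pos (by positivity : 0 < 2 * Real.pi), mul_add,
      mul_div_cancel₀ _ (by positivity)]
    linarith
  calc _ ≤ (2 * Real.pi * (1 + ‖-τ / (2 * Real.pi)‖)) ^ N * _ := by gcongr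
    _ = (2 * Real.pi) ^ N * _ := by rw [mul_pow, mul_assoc]
    _ ≤ _ := by gcongr

lemma core_bound (μ : Measure ℝ) [SFinite μ] (w : ℝ → ℂ) (hw : Integrable w μ)
    (hs : ∀ᵐ s ∂μ, |s| ≤ 1)
    (ψ : ℝ → ℂ) (h1 : HasCompactSupport ψ) (h2 : ContDiff ℝ (⊤ : ℕ∞) ψ) (N : ℕ) :
    ∃ C : ℝ, 0 ≤ C ∧ ∀ r₁ r₂ t : ℝ, 0 < r₁ → r₁ ≤ 1 → 0 < r₂ → r₂ ≤ 1 → 1 ≤ |t| →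
      ‖∫ ρ : ℝ, Complex.exp (Complex.I * (t : ℂ) * (ρ : ℂ)) *
        ((∫ s, Complex.exp (Complex.I * (s : ℂ) * ((r₁ * ρ : ℝ) : ℂ)) * w s ∂μ) *
        (∫ s, Complex.exp (Complex.I * (s : ℂ) * ((r₂ * ρ : ℝ) : ℂ)) * w s ∂μ)) * ψ ρ‖ ≤
        C * |t| ^ (-(N : ℝ)) := by
  obtain ⟨C, hC, hdec⟩ := fourier_decay ψ h1 h2 N
  have hww : Integrable (fun z : ℝ × ℝ => w z.1 * w z.2) (μ.prod μ) := hw.mul_prod hw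
  have hψ : Integrable ψ := h2.continuous.integrable_of_hasCompactSupport h1
  refine ⟨2 ^ N * C * ∫ z : ℝ × ℝ, ‖w z.1 * w z.2‖ ∂(μ.prod μ), ?_, ?_⟩
  · have : 0 ≤ ∫ z : ℝ × ℝ, ‖w z.1 * w z.2‖ ∂(μ.prod μ) :=
      integral_nonneg fun _ => norm_nonneg _
    positivity
  intro r₁ r₂ t hr1 hr1' hr2 hr2' ht
  have key : (∫ ρ : ℝ, Complex.exp (Complex.I * (t : ℂ) * (ρ : ℂ)) *
        ((∫ s, Complex.exp (Complex.I * (s : ℂ) * ((r₁ * ρ : ℝ) : ℂ)) * w s ∂μ) *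
        (∫ s, Complex.exp (Complex.I * (s : ℂ) * ((r₂ * ρ : ℝ) : ℂ)) * w s ∂μ)) * ψ ρ) =
      ∫ z : ℝ × ℝ, (w z.1 * w z.2) * (∫ ρ : ℝ, Complex.exp
        (Complex.I * ((t + z.1 * r₁ + z.2 * r₂ : ℝ) : ℂ) * (ρ : ℂ)) * ψ ρ) ∂(μ.prod μ) := by
    have hint : Integrable (Function.uncurry fun (ρ : ℝ) (z : ℝ × ℝ) => Complex.exp
        (Complex.I * ((t + z.1 * r₁ + z.2 * r₂ : ℝ) : ℂ) * (ρ : ℂ)) * (ψ ρ * (w z.1 * w z.2)))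
        (volume.prod (μ.prod μ)) := by
      refine Integrable.bdd_mul (c := 1) (hψ.mul_prod hww) ?_ ?_
      · refine Continuous.aestronglyMeasurable ?_
        fun_prop
      · refine Filter.Eventually.of_forall fun z => ?_
        rw [mul_assoc, ← Complex.ofReal_mul, mul_comm, Complex.norm_exp_ofReal_mul_I]
    have := integral_integral_swap hint
    calc _ = _ := ?_
      _ = _ := this
      _ = _ := ?_
    · congr 1 with ρ
      rw [← integral_prod_mul, ← integral_const_mul, ← integral_mul_const]
      congr 1 with z
      have : Complex.exp (Complex.I * ((t + z.1 * r₁ + z.2 * r₂ : ℝ) : ℂ) * (ρ : ℂ)) =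
        Complex.exp (Complex.I * (t : ℂ) * (ρ : ℂ)) *
        (Complex.exp (Complex.I * (z.1 : ℂ) * ((r₁ * ρ : ℝ) : ℂ)) *
         Complex.exp (Complex.I * (z.2 : ℂ) * ((r₂ * ρ : ℝ) : ℂ))) := by
        rw [← Complex.exp_add, ← Complex.exp_add]
        congr 1
        push_cast
        ring
      rw [this]
      ring
    · congr 1 with z
      rw [← integral_const_mul]
      congr 1 with ρ
      ring
  rw [key]
  have hsz : ∀ᵐ z ∂(μ.prod μ), |z.1| ≤ 1 ∧ |z.2| ≤ 1 := by
    have a1 : ∀ᵐ z ∂(μ.prod μ), |z.1| ≤ 1 := Measure.quasiMeasurePreserving_fst.ae hs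
    have a2 : ∀ᵐ z ∂(μ.prod μ), |z.2| ≤ 1 := Measure.quasiMeasurePreserving_snd.ae hs
    exact a1.and a2
  have hb : ∀ᵐ z ∂(μ.prod μ), ‖(w z.1 * w z.2) * ∫ ρ : ℝ, Complex.exp
        (Complex.I * ((t + z.1 * r₁ + z.2 * r₂ : ℝ) : ℂ) * (ρ : ℂ)) * ψ ρ‖ ≤
        ‖w z.1 * w z.2‖ * (2 ^ N * C * |t| ^ (-(N : ℝ))) := by
    filter_upwards [hsz] with z hz
    rw [norm_mul]
    refine mul_le_mul_of_nonneg_left ?_ (norm_nonneg _)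
    have hd := hdec (t + z.1 * r₁ + z.2 * r₂)
    set τ := t + z.1 * r₁ + z.2 * r₂ with hτ
    have e1 : |z.1 * r₁| ≤ 1 := by
      rw [abs_mul, abs_of_pos hr1]; exact mul_le_one₀ hz.1 hr1.le hr1'
    have e2 : |z.2 * r₂| ≤ 1 := by
      rw [abs_mul, abs_of_pos hr2]; exact mul_le_one₀ hz.2 hr2.le hr2'
    have e3 : |t| ≤ 2 * (1 + |τ|) := by
      have : t = τ - z.1 * r₁ - z.2 * r₂ := by rw [hτ]; ring
      have q1 := abs_sub (τ - z.1 * r₁) (z.2 * r₂)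
      have q2 := abs_sub τ (z.1 * r₁)
      rw [← this] at q1
      linarith [abs_nonneg τ]
    have tp : 0 < |t| := by linarith
    rw [Real.rpow_neg tp.le, Real.rpow_natCast, ← div_eq_mul_inv, le_div_iff₀ (by positivity)]
    calc _ ≤ ‖∫ ρ : ℝ, Complex.exp (Complex.I * (τ : ℂ) * (ρ : ℂ)) * ψ ρ‖ * (2 * (1 + |τ|)) ^ N := by
          gcongr
      _ = 2 ^ N * ((1 + |τ|) ^ N *
          ‖∫ ρ : ℝ, Complex.exp (Complex.I * (τ : ℂ) * (ρ : ℂ)) * ψ ρ‖) := by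
          rw [mul_pow]; ring
      _ ≤ _ := by gcongr
  refine (norm_integral_le_of_norm_le (hww.norm.mul_const _) hb).trans (le_of_eq ?_)
  rw [integral_mul_const]
  ring

lemma psi_contDiff (a : ℝ) (φ : ℝ → ℂ) (hφ : ContDiff ℝ (⊤ : ℕ∞) φ)
    (hφsupp : Function.support φ ⊆ Set.Icc (1 / 2 : ℝ) 2) :
    ContDiff ℝ (⊤ : ℕ∞) (fun ρ : ℝ => ((ρ ^ a : ℝ) : ℂ) * φ ρ) := by
  rw [contDiff_iff_contDiffAt]
  intro x
  by_cases hx : x < 1 / 2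
  · have : (fun ρ : ℝ => ((ρ ^ a : ℝ) : ℂ) * φ ρ) =ᶠ[nhds x] fun _ => 0 := by
      filter_upwards [Iio_mem_nhds hx] with y hy
      have : φ y = 0 := by
        by_contra h
        exact absurd (hφsupp h).1 (not_le.mpr hy)
      simp [this]
    exact contDiffAt_const.congr_of_eventuallyEq this
  · have hx0 : x ≠ 0 := by intro h; apply hx; rw [h]; norm_num
    refine ContDiffAt.mul ?_ hφ.contDiffAt
    exact Complex.ofRealCLM.contDiff.contDiffAt.comp x (Real.contDiffAt_rpow_const_of_ne hx0)

/-- For `ν > 0`, `N ∈ ℕ` and a smooth `φ` supported in `[1/2,2]`, there is a constant `C`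
such that for all `r₁, r₂ ∈ (0,1]` and `|t| ≥ 1`:
`|∫_0^∞ e^{itρ} J_ν(r₁ρ) J_ν(r₂ρ) φ(ρ) ρ dρ| ≤ C (r₁r₂)^ν |t|^{-N}`. -/
theorem low_frequency_kernel_bound (ν : ℝ) (hν : 0 < ν) (N : ℕ)
    (φ : ℝ → ℂ) (hφ : ContDiff ℝ (⊤ : ℕ∞) φ)
    (hφsupp : Function.support φ ⊆ Set.Icc (1 / 2 : ℝ) 2) :
    ∃ C : ℝ, 0 < C ∧ ∀ r₁ r₂ t : ℝ, 0 < r₁ → r₁ ≤ 1 → 0 < r₂ → r₂ ≤ 1 → 1 ≤ |t| →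
      ‖∫ ρ in Set.Ioi (0 : ℝ),
          Complex.exp (Complex.I * (t : ℂ) * (ρ : ℂ)) * besselJ ν (r₁ * ρ) *
            besselJ ν (r₂ * ρ) * φ ρ * (ρ : ℂ)‖ ≤
        C * (r₁ * r₂) ^ ν * |t| ^ (-(N : ℝ)) := by
  set w : ℝ → ℂ := fun s => (((1 - s ^ 2) ^ (ν - 1 / 2) : ℝ) : ℂ) with hwdef
  set μ : Measure ℝ := volume.restrict (Set.Ioc (-1 : ℝ) 1) with hμ
  set c : ℝ := Real.Gamma (ν + 1 / 2) * Real.Gamma (1 / 2) with hc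
  have hJ : ∀ r, besselJ ν r = (((r / 2) ^ ν / c : ℝ) : ℂ) *
      ∫ s, Complex.exp (Complex.I * (s : ℂ) * (r : ℂ)) * w s ∂μ := by
    intro r
    rw [besselJ, intervalIntegral.integral_of_le (by norm_num)]
  by_cases hw : Integrable w μ
  swap
  · have hz : ∀ r, besselJ ν r = 0 := by
      intro r
      rw [hJ, integral_undef, mul_zero]
      intro hi
      apply hw
      have := Integrable.bdd_mul (c := 1)
        (f := fun s : ℝ => Complex.exp (-(Complex.I * (s : ℂ) * (r : ℂ)))) hi
        (Continuous.aestronglyMeasurable (by fun_prop)) (Filter.Eventually.of_forall fun s => by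
          have : -(Complex.I * (s : ℂ) * (r : ℂ)) = ((-(s * r) : ℝ) : ℂ) * Complex.I := by
            push_cast; ring
          rw [this, Complex.norm_exp_ofReal_mul_I])
      refine this.congr (Filter.Eventually.of_forall fun s => ?_)
      simp only
      rw [← mul_assoc, ← Complex.exp_add]
      simp
    refine ⟨1, one_pos, fun r₁ r₂ t h1 _ h2 _ ht => ?_⟩
    simp only [hz, mul_zero, zero_mul, integral_zero, norm_zero]
    positivity
  have hsupp0 : ∀ x, x ∉ Set.Icc (1 / 2 : ℝ) 2 → φ x = 0 := fun x hx => by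
    by_contra h
    exact hx (hφsupp h)
  have hcs : HasCompactSupport (fun ρ : ℝ => ((ρ ^ (2 * ν + 1) : ℝ) : ℂ) * φ ρ) :=
    HasCompactSupport.intro (isCompact_Icc (a := (1 / 2 : ℝ)) (b := 2)) fun x hx => by
      simp [hsupp0 x hx]
  have hs : ∀ᵐ s ∂μ, |s| ≤ 1 := by
    filter_upwards [ae_restrict_mem measurableSet_Ioc] with s hs
    exact abs_le.mpr ⟨hs.1.le, hs.2⟩
  obtain ⟨C, hC, hb⟩ := core_bound μ w hw hs _ hcs (psi_contDiff (2 * ν + 1) φ hφ hφsupp) N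
  have hcpos : 0 < c := mul_pos (Real.Gamma_pos_of_pos (by linarith))
    (Real.Gamma_pos_of_pos (by norm_num))
  set K : ℝ := ((1 / 2) ^ ν / c) ^ 2 with hK
  have hK0 : 0 ≤ K := sq_nonneg _
  refine ⟨K * C + 1, by positivity, fun r₁ r₂ t h1 h1' h2 h2' ht => ?_⟩
  have hbb := hb r₁ r₂ t h1 h1' h2 h2' ht
  have e : (∫ ρ in Set.Ioi (0 : ℝ),
          Complex.exp (Complex.I * (t : ℂ) * (ρ : ℂ)) * besselJ ν (r₁ * ρ) *
            besselJ ν (r₂ * ρ) * φ ρ * (ρ : ℂ)) = ((K * (r₁ * r₂) ^ ν : ℝ) : ℂ) *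
      ∫ ρ : ℝ, Complex.exp (Complex.I * (t : ℂ) * (ρ : ℂ)) *
        ((∫ s, Complex.exp (Complex.I * (s : ℂ) * ((r₁ * ρ : ℝ) : ℂ)) * w s ∂μ) *
        (∫ s, Complex.exp (Complex.I * (s : ℂ) * ((r₂ * ρ : ℝ) : ℂ)) * w s ∂μ)) *
        (((ρ ^ (2 * ν + 1) : ℝ) : ℂ) * φ ρ) := by
    rw [setIntegral_eq_integral_of_forall_compl_eq_zero, ← integral_const_mul]
    · congr 1 with ρ
      by_cases hρ : ρ ∈ Set.Icc (1 / 2 : ℝ) 2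
      swap
      · simp [hsupp0 ρ hρ]
      have hρ0 : 0 < ρ := by linarith [hρ.1]
      rw [hJ, hJ]
      have q : ((r₁ * ρ / 2) ^ ν / c) * ((r₂ * ρ / 2) ^ ν / c) * ρ =
          K * (r₁ * r₂) ^ ν * ρ ^ (2 * ν + 1) := by
        rw [Real.rpow_add hρ0, Real.rpow_one, two_mul, Real.rpow_add hρ0, hK,
          show r₁ * ρ / 2 = r₁ * ρ * (1 / 2) by ring, show r₂ * ρ / 2 = r₂ * ρ * (1 / 2) by ring,
          Real.mul_rpow (by positivity) (by positivity),
          Real.mul_rpow (by positivity) (by positivity),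
          Real.mul_rpow (by positivity) (by positivity),
          Real.mul_rpow (by positivity) (by positivity),
          Real.mul_rpow (by positivity) (by positivity)]
        ring
      have q' := congrArg (fun x : ℝ => (x : ℂ)) q
      simp only [Complex.ofReal_mul] at q'
      simp only [Complex.ofReal_mul]
      generalize (∫ s, Complex.exp (Complex.I * (s : ℂ) * ((r₁ : ℂ) * (ρ : ℂ))) * w s ∂μ) = A
      generalize (∫ s, Complex.exp (Complex.I * (s : ℂ) * ((r₂ : ℂ) * (ρ : ℂ))) * w s ∂μ) = B
      linear_combination (Complex.exp (Complex.I * (t : ℂ) * (ρ : ℂ)) * A * B * φ ρ) * q'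
    · intro x hx
      have : φ x = 0 := hsupp0 x fun h => hx (by have := h.1; simp only [Set.mem_Ioi]; linarith)
      simp [this]
  have hr : 0 < (r₁ * r₂) ^ ν := by positivity
  have hT : 0 ≤ |t| ^ (-(N : ℝ)) := by positivity
  rw [e, norm_mul, Complex.norm_real, Real.norm_of_nonneg (by positivity)]
  calc _ ≤ K * (r₁ * r₂) ^ ν * (C * |t| ^ (-(N : ℝ))) := by gcongr
    _ ≤ _ := by nlinarith [mul_nonneg hr.le hT]
end
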